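/- Let the edges of the complete graph K_n be coloured, let α be a colour and let v be a vertex, such that every vertex other than v is incident to edges of at most one colour different from α. Then there are two disjoint monochromatic cycles of different colours, one of them of colour α, that together cover all vertices of K_n. -/

import Mathlib

/-- `S` is the vertex set of a monochromatic cycle of colour `col` in the complete graph
`K_n` coloured by `χ`; the empty set, single vertices and single edges count as degenerate
cycles (the empty set being a cycle of any colour). -/
def IsMonoCycle {n : ℕ} (χ : Fin n → Fin n → ℕ) (col : ℕ) (S : Finset (Fin n)) : Prop :=
  S = ∅ ∨
  (∃ v, S = {v}) ∨
  (∃ v w : Fin n, v ≠ w ∧ S = {v, w} ∧ χ v w = col) ∨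
  (∃ (v : Fin n) (p : (⊤ : SimpleGraph (Fin n)).Walk v v),
    p.IsCycle ∧ p.support.toFinset = S ∧ ∀ x y : Fin n, s(x, y) ∈ p.edges → χ x y = col)

set_option linter.unusedSectionVars false
namespace Lehel

variable {V : Type*}

inductive HP (G : SimpleGraph V) : Multiset V → V → V → Prop
  | single (a : V) : HP G {a} a a
  | cons {a b c : V} {S : Multiset V} : G.Adj a b → HP G S b c → HP G ({a} + S) a c

theorem HP.join {G : SimpleGraph V} {S T : Multiset V} {a b c d : V} (h : HP G S a b)
    (hbc : G.Adj b c) (h' : HP G T c d) : HP G (S + T) a d := by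
  induction h with
  | single a => exact HP.cons hbc h'
  | cons h1 _ ih => rw [add_assoc]; exact HP.cons h1 (ih hbc)

theorem HP.snoc {G : SimpleGraph V} {S : Multiset V} {a b c : V} (h : HP G S a b)
    (hbc : G.Adj b c) : HP G (S + {c}) a c := h.join hbc (HP.single c)

theorem HP.rev {G : SimpleGraph V} {S : Multiset V} {a b : V} (h : HP G S a b) : HP G S b a := by
  induction h with
  | single a => exact HP.single a
  | cons h1 _ ih => rw [add_comm]; exact ih.snoc h1.symm

theorem HP.eqv {G : SimpleGraph V} {S T : Multiset V} {a b : V} (h : HP G S a b) (e : S = T) :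
    HP G T a b := e ▸ h

theorem HP.left {G : SimpleGraph V} {S : Multiset V} {a b : V} (h : HP G S a b) : a ∈ S := by
  cases h <;> simp

theorem HP.right {G : SimpleGraph V} {S : Multiset V} {a b : V} (h : HP G S a b) : b ∈ S :=
  h.rev.left

/-- head decomposition -/
theorem HP.dec {G : SimpleGraph V} {S : Multiset V} {a b : V} (h : HP G S a b) :
    (S = {a} ∧ a = b) ∨ ∃ T c, S = {a} + T ∧ G.Adj a c ∧ HP G T c b := by
  cases h with
  | single => exact Or.inl ⟨rfl, rfl⟩
  | cons h1 h2 => exact Or.inr ⟨_, _, rfl, h1, h2⟩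

theorem HP.dec2 {G : SimpleGraph V} {S : Multiset V} {a b : V} (h : HP G S a b)
    (hc : 2 ≤ Multiset.card S) : ∃ T c, S = {a} + T ∧ G.Adj a c ∧ HP G T c b := by
  rcases h.dec with ⟨h1, _⟩ | h1
  · subst h1; simp at hc
  · exact h1

theorem HP.card_pos {G : SimpleGraph V} {S : Multiset V} {a b : V} (h : HP G S a b) :
    1 ≤ Multiset.card S := by
  cases h <;> simp

def HC (G : SimpleGraph V) (S : Multiset V) : Prop :=
  S = 0 ∨ ∃ a b, HP G S a b ∧ (a = b ∨ G.Adj b a)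

theorem HC.eqv {G : SimpleGraph V} {S T : Multiset V} (h : HC G S) (e : S = T) : HC G T := e ▸ h

theorem HP.close {G : SimpleGraph V} {S : Multiset V} {a b : V} (h : HP G S a b)
    (hba : G.Adj b a) : HC G S := Or.inr ⟨a, b, h, Or.inr hba⟩

theorem HC.zero {G : SimpleGraph V} : HC G (0 : Multiset V) := Or.inl rfl
theorem HC.one {G : SimpleGraph V} (a : V) : HC G ({a} : Multiset V) :=
  Or.inr ⟨a, a, HP.single a, Or.inl rfl⟩

section
variable [Fintype V]

def Sol (G : SimpleGraph V) : Prop :=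
  ∃ S T : Multiset V, HC G S ∧ HC Gᶜ T ∧ S + T = (Finset.univ : Finset V).val

theorem Sol.compl {G : SimpleGraph V} (h : Sol Gᶜ) : Sol G := by
  obtain ⟨S, T, h1, h2, h3⟩ := h
  rw [compl_compl] at h2
  exact ⟨T, S, h2, h1, by rw [add_comm]; exact h3⟩

structure Ctx (G : SimpleGraph V) (m : ℕ) : Prop where
  ns : ¬ Sol G
  mn : ∀ (R Q : Multiset V) (a b : V), HC G R → HP Gᶜ Q a b →
    R + Q = (Finset.univ : Finset V).val → m ≤ Multiset.card Q
  mn' : ∀ (R Q : Multiset V) (a b : V), HC Gᶜ R → HP G Q a b →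
    R + Q = (Finset.univ : Finset V).val → m ≤ Multiset.card Q

structure Cf (G : SimpleGraph V) (m : ℕ) (R Q : Multiset V) (q p : V) : Prop where
  hR : HC G R
  hQ : HP Gᶜ Q q p
  hU : R + Q = (Finset.univ : Finset V).val
  hc : Multiset.card Q = m

def X (G : SimpleGraph V) (q p x : V) : Prop := Gᶜ.Adj q x ∧ Gᶜ.Adj p x

theorem Cf.symm {G : SimpleGraph V} {m : ℕ} {R Q : Multiset V} {q p : V} (h : Cf G m R Q q p) :
    Cf G m R Q p q := ⟨h.hR, h.hQ.rev, h.hU, h.hc⟩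

variable {G : SimpleGraph V} {m : ℕ} {R Q : Multiset V} {q p : V}

theorem nodupU (R Q : Multiset V) (h : R + Q = (Finset.univ : Finset V).val) : (R + Q).Nodup := by
  rw [h]; exact Finset.univ.nodup

theorem Cf.ne (h : Cf G m R Q q p) {x y : V} (hx : x ∈ R) (hy : y ∈ Q) : x ≠ y := by
  have := nodupU _ _ h.hU
  rw [Multiset.nodup_add] at this
  rintro rfl
  exact Multiset.disjoint_left.1 this.2.2 hx hy

theorem Cf.ndR (h : Cf G m R Q q p) : R.Nodup := by
  have := nodupU _ _ h.hU
  rw [Multiset.nodup_add] at this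
  exact this.1

theorem Cf.ndQ (h : Cf G m R Q q p) : Q.Nodup := by
  have := nodupU _ _ h.hU
  rw [Multiset.nodup_add] at this
  exact this.2.1

theorem blue {a b : V} (h : a ≠ b) (h' : ¬ G.Adj a b) : Gᶜ.Adj a b := by
  rw [SimpleGraph.compl_adj]; exact ⟨h, h'⟩

theorem red {a b : V} (h : a ≠ b) (h' : ¬ Gᶜ.Adj a b) : G.Adj a b := by
  rw [SimpleGraph.compl_adj] at h'; tauto

theorem notboth {a b : V} (h : G.Adj a b) (h' : Gᶜ.Adj a b) : False := by
  rw [SimpleGraph.compl_adj] at h'; tauto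

theorem Cf.notX (h : Cf G m R Q q p) {x : V} (hx : x ∈ R) (hX : ¬ X G q p x) :
    G.Adj q x ∨ G.Adj p x := by
  have h1 := (h.ne hx h.hQ.left).symm
  have h2 := (h.ne hx h.hQ.right).symm
  by_contra hcon
  push Not at hcon
  exact hX ⟨blue h1 hcon.1, blue h2 hcon.2⟩

theorem Cf.m3 (C : Ctx G m) (h : Cf G m R Q q p) : 3 ≤ m := by
  by_contra hm
  have hcard := h.hc
  have hp := h.hQ.card_pos
  apply C.ns
  refine ⟨R, Q, h.hR, ?_, h.hU⟩
  rcases h.hQ.dec with ⟨h1, h2⟩ | ⟨T, c, h1, h2, h3⟩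
  · rw [h1]; exact HC.one _
  · rcases h3.dec with ⟨h4, h5⟩ | ⟨T', c', h4, h5, h6⟩
    · subst h5; exact h.hQ.close h2.symm
    · have := h6.card_pos
      rw [h1, h4] at hcard
      simp at hcard
      omega

/-- F1 -/
theorem Cf.f1 (C : Ctx G m) (h : Cf G m R Q q p) : ¬ Gᶜ.Adj p q := fun hh =>
  C.ns ⟨R, Q, h.hR, h.hQ.close hh, h.hU⟩

theorem Cf.qp_ne (C : Ctx G m) (h : Cf G m R Q q p) : q ≠ p := by
  have h3 := h.m3 C
  have hc := h.hc
  obtain ⟨T, c, h1, h2, h4⟩ := h.hQ.dec2 (by omega)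
  have := h.ndQ
  rw [h1, Multiset.nodup_add] at this
  rintro rfl
  exact Multiset.disjoint_left.1 this.2.2 (by simp) h4.right

theorem Cf.qp (C : Ctx G m) (h : Cf G m R Q q p) : G.Adj q p :=
  (red (h.qp_ne C).symm (h.f1 C)).symm

/-- middle decomposition -/
theorem Cf.mid (C : Ctx G m) (h : Cf G m R Q q p) : ∃ M a b, Q = {q} + M + {p} ∧
    Gᶜ.Adj q a ∧ Gᶜ.Adj b p ∧ HP Gᶜ M a b := by
  have h3 := h.m3 C
  have hc := h.hc
  obtain ⟨T, c, h1, h2, h4⟩ := h.hQ.dec2 (by omega)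
  have : 2 ≤ Multiset.card T := by rw [h1] at hc; simp at hc; omega
  obtain ⟨T', c', h1', h2', h4'⟩ := h4.rev.dec2 this
  exact ⟨T', c, c', by rw [h1, h1']; abel, h2, h2'.symm, h4'.rev⟩

theorem Cf.f2a (C : Ctx G m) (h : Cf G m R Q q p) {u w : V} (hp : HP G R u w)
    (h1 : G.Adj q u) (h2 : G.Adj q w) : False := by
  have h3 := h.m3 C
  have hc := h.hc
  obtain ⟨T, c, e1, e2, e4⟩ := h.hQ.dec2 (by omega)
  have := C.mn ({q} + R) T c p ((HP.cons h1 hp).close h2.symm) e4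
    (by rw [← h.hU, e1]; abel)
  rw [e1] at hc; simp at hc; omega

theorem Cf.f2b (C : Ctx G m) (h : Cf G m R Q q p) {u w : V} (hp : HP G R u w)
    (h1 : G.Adj q u) (h2 : G.Adj p w) : False := by
  have hc := h.hc
  obtain ⟨M, a, b, e1, e2, e3, e4⟩ := h.mid C
  have := C.mn ({q} + R + {p}) M a b (((HP.cons h1 hp).snoc h2.symm).close (h.qp C).symm) e4
    (by rw [← h.hU, e1]; abel)
  rw [e1] at hc; simp at hc; omega

/-- F2 -/
theorem Cf.f2 (C : Ctx G m) (h : Cf G m R Q q p) {u w : V} (hp : HP G R u w) :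
    X G q p u ∨ X G q p w := by
  by_contra hcon
  push Not at hcon
  rcases h.notX hp.left hcon.1 with h1 | h1 <;> rcases h.notX hp.right hcon.2 with h2 | h2
  · exact h.f2a C hp h1 h2
  · exact h.f2b C hp h1 h2
  · exact h.symm.f2b C hp h1 h2
  · exact h.symm.f2a C hp h1 h2

/-- F3/L4 -/
theorem Cf.l4 (C : Ctx G m) (h : Cf G m R Q q p) {I R' : Multiset V} {s t : V} (hI : HP Gᶜ I s t)
    (hs : Gᶜ.Adj q s) (ht : Gᶜ.Adj p t) (hR : HC G R') (e : R = I + R') : False :=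
  C.ns ⟨R', Q + I, hR, (h.hQ.join ht hI.rev).close hs.symm, by rw [← h.hU, e]; abel⟩

theorem Cf.f3 (C : Ctx G m) (h : Cf G m R Q q p) {x : V} {R' : Multiset V} (hx : X G q p x)
    (e : R = {x} + R') {u w : V} (hp : HP G R' u w) : Gᶜ.Adj u w := by
  by_contra hcon
  by_cases huw : u = w
  · exact h.l4 C (HP.single x) hx.1 hx.2 (Or.inr ⟨u, w, hp, Or.inl huw⟩) e
  · exact h.l4 C (HP.single x) hx.1 hx.2 (hp.close (red huw hcon).symm) e

/-- small R are impossible -/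
theorem Cf.r4 (C : Ctx G m) (h : Cf G m R Q q p) :
    ∃ a b, HP G R a b ∧ G.Adj b a ∧ 4 ≤ Multiset.card R := by
  have hc := h.hc
  have h3 := h.m3 C
  rcases h.hR with h0 | ⟨a, b, hp, hab⟩
  · obtain ⟨T, c, e1, e2, e4⟩ := h.hQ.dec2 (by omega)
    have := C.mn {q} T c p (HC.one q) e4 (by rw [← h.hU, e1, h0]; abel)
    rw [e1] at hc; simp at hc; omega
  · have key : ∀ a b, HP G R a b → X G q p a → 4 ≤ Multiset.card R := by
      intro a b hp hX
      rcases hp.dec with ⟨h1, h2⟩ | ⟨T, c, h1, h2, h3⟩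
      · exact (h.l4 C (HP.single a) hX.1 hX.2 HC.zero (by rw [h1]; simp)).elim
      · have hb := h.f3 C hX h1 h3
        rcases h3.dec with ⟨h4, h5⟩ | ⟨T', c', h4, h5, h6⟩
        · subst h5; simp at hb
        · rcases h6.dec with ⟨h7, h8⟩ | ⟨T'', c'', h7, h8, h9⟩
          · subst h8; exact (notboth h5 hb).elim
          · have := h9.card_pos
            rw [h1, h4, h7]; simp; omega
    have h4 : 4 ≤ Multiset.card R := by
      rcases h.f2 C hp with hX | hX
      · exact key a b hp hX
      · exact key b a hp.rev hX
    refine ⟨a, b, hp, ?_, h4⟩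
    rcases hab with rfl | hab
    · exfalso
      rcases hp.dec with ⟨h1, h2⟩ | ⟨T, c, h1, h2, h3⟩
      · rw [h1] at h4; simp at h4
      · have := h.ndR
        rw [h1, Multiset.nodup_add] at this
        exact Multiset.disjoint_left.1 this.2.2 (by simp) h3.right
    · exact hab
end

/-! ### segments -/

def sg (f : ℤ → V) (s : ℤ) : ℤ → ℕ → Multiset V
  | _, 0 => 0
  | a, n + 1 => {f a} + sg f s (a + s) n

theorem sg_add (f : ℤ → V) (s a : ℤ) (n k : ℕ) :
    sg f s a (n + k) = sg f s a n + sg f s (a + s * n) k := by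
  induction n generalizing a with
  | zero => simp [sg]
  | succ n ih =>
    rw [show n + 1 + k = (n + k) + 1 by ring]
    simp only [sg]
    rw [ih, show a + s * ((n + 1 : ℕ) : ℤ) = a + s + s * n by push_cast; ring]
    simp only [add_assoc]

theorem sg_one (f : ℤ → V) (s a : ℤ) : sg f s a 1 = {f a} := by simp [sg]

theorem sg_last (f : ℤ → V) (s a : ℤ) (n : ℕ) :
    sg f s a (n + 1) = sg f s a n + {f (a + s * n)} := by
  rw [sg_add, sg_one]

theorem card_sg (f : ℤ → V) (s a : ℤ) (n : ℕ) : Multiset.card (sg f s a n) = n := by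
  induction n generalizing a with
  | zero => simp [sg]
  | succ n ih => simp [sg, ih]

theorem mem_sg (f : ℤ → V) (s a : ℤ) (n : ℕ) (x : V) :
    x ∈ sg f s a n ↔ ∃ j : ℕ, j < n ∧ x = f (a + s * j) := by
  induction n generalizing a with
  | zero => simp [sg]
  | succ n ih =>
    simp only [sg, Multiset.mem_add, Multiset.mem_singleton, ih]
    constructor
    · rintro (rfl | ⟨j, hj, rfl⟩)
      · exact ⟨0, by omega, by simp⟩
      · exact ⟨j + 1, by omega, by congr 1; push_cast; ring⟩
    · rintro ⟨j, hj, rfl⟩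
      rcases j with _ | j
      · left; simp
      · right; exact ⟨j, by omega, by congr 1; push_cast; ring⟩

theorem sg_congr {f g : ℤ → V} {s a : ℤ} {n : ℕ}
    (h : ∀ j : ℕ, j < n → f (a + s * j) = g (a + s * j)) : sg f s a n = sg g s a n := by
  induction n with
  | zero => rfl
  | succ n ih =>
    rw [sg_last, sg_last, ih (fun j hj => h j (by omega)), h n (by omega)]

theorem sg_split2 (f : ℤ → V) (a : ℤ) (k : ℕ) :
    sg f 1 a (2 * k) = sg f 2 a k + sg f 2 (a + 1) k := by
  induction k generalizing a with
  | zero => simp [sg]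
  | succ k ih =>
    rw [show 2 * (k + 1) = 2 * k + 1 + 1 by ring]
    simp only [sg]
    rw [ih, show a + 1 + 1 = a + 2 by ring, show a + 2 + 1 = a + 1 + 2 by ring]
    abel

theorem sg_chain {G : SimpleGraph V} (f : ℤ → V) (s a : ℤ) (n : ℕ)
    (h : ∀ j : ℕ, j < n → G.Adj (f (a + s * j)) (f (a + s * j + s))) :
    HP G (sg f s a (n + 1)) (f a) (f (a + s * n)) := by
  induction n with
  | zero => rw [sg_one]; simpa using HP.single (G := G) (f a)
  | succ n ih =>
    have := (ih (fun j hj => h j (by omega))).snoc (h n (by omega))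
    rw [sg_last, show a + s * ((n + 1 : ℕ) : ℤ) = a + s * n + s by push_cast; ring]
    exact this

/-- the sequence lemma -/
theorem seq_lemma {B : SimpleGraph V} (f : ℤ → V) (s : ℤ) (S T : V → Prop)
    (hS : ∀ x y, S x → S y → x ≠ y → B.Adj x y) (hT : ∀ x y, T x → T y → x ≠ y → B.Adj x y)
    (S1 : Multiset V) (a : V) (b0 : ℤ) (h1 : HP B S1 a (f b0)) (n : ℕ)
    (hd : ∀ i j : ℕ, i < j → j ≤ n → f (b0 + s * i) ≠ f (b0 + s * j))
    (hl : ∀ j : ℕ, j < n → B.Adj (f (b0 + s * j)) (f (b0 + s * j + s)) ∨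
      (T (f (b0 + s * j)) ∧ S (f (b0 + s * j + s)))) :
    HP B (S1 + sg f s (b0 + s) n) a (f (b0 + s * n)) ∨
    ∃ n1 n2 : ℕ, n = n1 + n2 + 1 ∧ HP B (S1 + sg f s (b0 + s) n1) a (f (b0 + s * n1)) ∧
      T (f (b0 + s * n1)) ∧ S (f (b0 + s * n1 + s)) ∧
      HP B (sg f s (b0 + s * n1 + s) (n2 + 1)) (f (b0 + s * n1 + s)) (f (b0 + s * n)) := by
  induction n with
  | zero => left; simpa [sg] using h1
  | succ n ih =>
    have e1 : b0 + s * ((n + 1 : ℕ) : ℤ) = b0 + s * n + s := by push_cast; ring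
    have e2 : b0 + s + s * (n : ℤ) = b0 + s * n + s := by ring
    rcases ih (fun i j hij hj => hd i j hij (by omega)) (fun j hj => hl j (by omega)) with
      hA | ⟨n1, n2, hn, hB1, hB2, hB3, hB4⟩
    · rcases hl n (by omega) with h | ⟨h, h'⟩
      · left
        rw [sg_last, ← add_assoc, e1, e2]
        exact hA.snoc h
      · right
        refine ⟨n, 0, by omega, hA, h, h', ?_⟩
        rw [sg_one, e1]
        exact HP.single _
    · rcases hl n (by omega) with h | ⟨h, h'⟩
      · right
        refine ⟨n1, n2 + 1, by omega, hB1, hB2, hB3, ?_⟩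
        rw [sg_last, e1]
        have := hB4.snoc h
        rw [show b0 + s * (n1 : ℤ) + s + s * ((n2 + 1 : ℕ) : ℤ) = b0 + s * n + s by
          rw [hn]; push_cast; ring]
        exact this
      · left
        have t1 : B.Adj (f (b0 + s * n1)) (f (b0 + s * n)) :=
          hT _ _ hB2 h (hd n1 n (by omega) (by omega))
        have t2 : B.Adj (f (b0 + s * n1 + s)) (f (b0 + s * n + s)) := by
          refine hS _ _ hB3 h' ?_
          have := hd (n1 + 1) (n + 1) (by omega) (by omega)
          rw [e1] at this
          convert this using 2; push_cast; ring
        have := (hB1.join t1 hB4.rev).snoc t2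
        rw [e1]
        refine this.eqv ?_
        have e3 : sg f s (b0 + s) n = sg f s (b0 + s) n1 + sg f s (b0 + s * n1 + s) (n2 + 1) := by
          rw [hn, show n1 + n2 + 1 = n1 + (n2 + 1) by ring, sg_add _ _ _ n1 (n2 + 1),
            show b0 + s + s * (n1 : ℤ) = b0 + s * n1 + s by ring]
        rw [sg_last f s (b0 + s) n, e2, e3]
        simp only [add_assoc]

structure Cyc (G : SimpleGraph V) (r : ℕ) (f : ℤ → V) : Prop where
  r4 : 4 ≤ r
  per : ∀ i : ℤ, f (i + r) = f i
  inj : ∀ i j : ℤ, i < j → j < i + r → f i ≠ f j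
  adj : ∀ i : ℤ, G.Adj (f i) (f (i + 1))

section
variable {G : SimpleGraph V} {r : ℕ} {f : ℤ → V}

theorem Cyc.perm (h : Cyc G r f) (i t : ℤ) : f (i + t * r) = f i := by
  induction t using Int.induction_on with
  | zero => simp
  | succ t ih => rw [show i + ((t : ℤ) + 1) * r = i + t * r + r by ring, h.per, ih]
  | pred t ih => rw [← ih, ← h.per, show i + (-(t : ℤ) - 1) * r + r = i + -t * r by ring]

theorem Cyc.window (h : Cyc G r f) (i j : ℤ) : ∃ t : ℤ, i ≤ j + t * r ∧ j + t * r < i + r := by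
  have hr : (0 : ℤ) < r := by have := h.r4; omega
  refine ⟨-((j - i) / r), ?_, ?_⟩
  · have := Int.emod_nonneg (j - i) hr.ne'
    have h2 := Int.emod_add_mul_ediv (j - i) r
    nlinarith
  · have := Int.emod_lt_of_pos (j - i) hr
    have h2 := Int.emod_add_mul_ediv (j - i) r
    nlinarith

theorem Cyc.shift (h : Cyc G r f) (a : ℤ) : Cyc G r (fun i => f (i + a)) where
  r4 := h.r4
  per i := by rw [show i + r + a = i + a + r by ring, h.per]
  inj i j h1 h2 := h.inj _ _ (by omega) (by omega)
  adj i := by rw [show i + 1 + a = i + a + 1 by ring]; exact h.adj _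

theorem Cyc.neg (h : Cyc G r f) : Cyc G r (fun i => f (-i)) where
  r4 := h.r4
  per i := by rw [← h.per, show -(i + r) + r = -i by ring]
  inj i j h1 h2 := (h.inj _ _ (by omega) (by omega)).symm
  adj i := by
    have := (h.adj (-(i + 1))).symm
    rwa [show -(i + 1) + 1 = -i by ring] at this

theorem sg1_succ (h : Cyc G r f) (a : ℤ) : sg f 1 (a + 1) r = sg f 1 a r := by
  obtain ⟨r', rfl⟩ : ∃ r', r = r' + 1 := ⟨r - 1, by have := h.r4; omega⟩
  rw [sg_last]
  have := h.per a
  rw [show a + 1 + 1 * (r' : ℤ) = a + (r' + 1 : ℕ) by push_cast; ring, this]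
  simp only [sg]
  rw [add_comm]

theorem sg1_all (h : Cyc G r f) (a : ℤ) : sg f 1 a r = sg f 1 0 r := by
  induction a using Int.induction_on with
  | zero => rfl
  | succ t ih => rw [sg1_succ h, ih]
  | pred t ih => rw [← ih, ← sg1_succ h (-t - 1)]; congr 1; ring

theorem sg2_succ {k : ℕ} (h : Cyc G (2 * k) f) (a : ℤ) : sg f 2 (a + 2) k = sg f 2 a k := by
  obtain ⟨k', rfl⟩ : ∃ k', k = k' + 1 := ⟨k - 1, by have := h.r4; omega⟩
  rw [sg_last]
  have := h.per a
  rw [show a + 2 + 2 * (k' : ℤ) = a + (2 * (k' + 1) : ℕ) by push_cast; ring, this]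
  simp only [sg]
  rw [add_comm]

theorem sg2_all {k : ℕ} (h : Cyc G (2 * k) f) (a t : ℤ) : sg f 2 (a + 2 * t) k = sg f 2 a k := by
  induction t using Int.induction_on with
  | zero => simp
  | succ t ih => rw [show a + 2 * ((t : ℤ) + 1) = a + 2 * t + 2 by ring, sg2_succ h, ih]
  | pred t ih => rw [← ih, ← sg2_succ h]; congr 1; ring

theorem sg2_odd {k : ℕ} (h : Cyc G (2 * k + 1) f) (a : ℤ) :
    sg f 2 a (2 * k + 1) = sg f 1 a (2 * k + 1) := by
  rw [show 2 * k + 1 = (k + 1) + k by ring, sg_add, show k + 1 + k = 2 * k + 1 by ring, sg_last _ 1,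
    sg_split2]
  have : sg f 2 (a + 2 * ((k + 1 : ℕ) : ℤ)) k = sg f 2 (a + 1) k := by
    have e : sg f 2 (a + 2 * ((k + 1 : ℕ) : ℤ)) k = sg (fun i => f (i + (2 * k + 1 : ℕ))) 2 (a + 1) k := by
      clear h
      generalize ha : a + 2 * ((k + 1 : ℕ) : ℤ) = b
      have hb : b = a + 1 + (2 * k + 1 : ℕ) := by rw [← ha]; push_cast; ring
      have : ∀ (n : ℕ) (c d z : ℤ), c = d + z → sg f 2 c n = sg (fun i => f (i + z)) 2 d n := by
        intro n
        induction n with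
        | zero => intros; rfl
        | succ n ih =>
          intro c d z hcd
          simp only [sg]
          rw [ih (c + 2) (d + 2) z (by rw [hcd]; ring), hcd]
      exact this _ _ _ _ hb
    rw [e]
    apply sg_congr
    intro j _
    exact h.per _
  rw [this, sg_last, show a + 1 * ((2 * k : ℕ) : ℤ) = a + 2 * (k : ℤ) by push_cast; ring]
  abel

/-- distinctness -/
theorem Cyc.ne (h : Cyc G r f) {i j : ℤ} (h1 : i - j < r) (h2 : j - i < r) (h3 : i ≠ j) :
    f i ≠ f j := by
  rcases lt_or_gt_of_ne h3 with h4 | h4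
  · exact h.inj _ _ h4 (by omega)
  · exact (h.inj _ _ h4 (by omega)).symm

theorem Cyc.eq_dvd (h : Cyc G r f) {i j : ℤ} (e : f i = f j) : ∃ t : ℤ, j = i + t * r := by
  obtain ⟨t, h1, h2⟩ := h.window i j
  rcases h1.eq_or_lt with h3 | h3
  · exact ⟨-t, by rw [h3]; ring⟩
  · exact (h.inj _ _ h3 h2 (by rw [h.perm, e])).elim

theorem Cyc.arc (h : Cyc G r f) (a : ℤ) (n : ℕ) : HP G (sg f 1 a (n + 1)) (f a) (f (a + n)) := by
  have := sg_chain (G := G) f 1 a n (fun j _ => h.adj _)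
  simpa using this
end

section
variable [Fintype V]

structure Cp (G : SimpleGraph V) (m r : ℕ) (f : ℤ → V) (Q : Multiset V) (q p : V) : Prop where
  cf : Cf G m (sg f 1 0 r) Q q p
  cy : Cyc G r f

variable {G : SimpleGraph V} {m r : ℕ} {f : ℤ → V} {Q : Multiset V} {q p : V}

theorem Cp.symm (h : Cp G m r f Q q p) : Cp G m r f Q p q := ⟨h.cf.symm, h.cy⟩

theorem X.symm {x : V} (h : X G q p x) : X G p q x := ⟨h.2, h.1⟩

theorem Cp.mem (h : Cp G m r f Q q p) (i : ℤ) : f i ∈ sg f 1 0 r := by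
  obtain ⟨t, h1, h2⟩ := h.cy.window 0 i
  rw [mem_sg]
  refine ⟨(i + t * r).toNat, by omega, ?_⟩
  rw [← h.cy.perm i t]
  congr 1
  omega

theorem Cp.shift (h : Cp G m r f Q q p) (a : ℤ) : Cp G m r (fun i => f (i + a)) Q q p := by
  refine ⟨?_, h.cy.shift a⟩
  have : ∀ (n : ℕ) (c : ℤ), sg (fun i => f (i + a)) 1 c n = sg f 1 (c + a) n := by
    intro n
    induction n with
    | zero => intros; rfl
    | succ n ih =>
      intro c
      simp only [sg]
      rw [ih (c + 1), show c + 1 + a = c + a + 1 by ring]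
  rw [this, sg1_all h.cy]
  exact h.cf

theorem Cp.consX (C : Ctx G m) (h : Cp G m r f Q q p) (i : ℤ) : X G q p (f i) ∨ X G q p (f (i + 1)) := by
  have hr := h.cy.r4
  have := h.cy.arc (i + 1) (r - 1)
  rw [show r - 1 + 1 = r by omega, sg1_all h.cy, show i + 1 + ((r - 1 : ℕ) : ℤ) = i + r by omega,
    h.cy.per] at this
  exact (h.cf.f2 C this).symm

theorem Cp.d2 (C : Ctx G m) (h : Cp G m r f Q q p) {i : ℤ} (hX : X G q p (f i)) :
    Gᶜ.Adj (f (i - 1)) (f (i + 1)) := by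
  have hr := h.cy.r4
  have := h.cy.arc (i + 1) (r - 2)
  rw [show r - 2 + 1 = r - 1 by omega,
    show i + 1 + ((r - 2 : ℕ) : ℤ) = (i - 1) + r by omega, h.cy.per] at this
  refine (h.cf.f3 C hX ?_ this).symm
  rw [← sg1_all h.cy i]
  obtain ⟨r', rfl⟩ : ∃ r', r = r' + 1 := ⟨r - 1, by omega⟩
  simp [sg]

theorem Cp.win (h : Cp G m r f Q q p) {i j : ℤ} (hne : f i ≠ f j) :
    ∃ (d : ℕ) (t : ℤ), 1 ≤ d ∧ d < r ∧ j + t * r = i + d := by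
  obtain ⟨t, h1, h2⟩ := h.cy.window i j
  refine ⟨(j + t * r - i).toNat, t, ?_, by omega, by omega⟩
  rcases h1.eq_or_lt with h3 | h3
  · exact (hne (by rw [h3, h.cy.perm])).elim
  · omega

theorem Cp.cliqueP (C : Ctx G m) (h : Cp G m r f Q q p) {i j : ℤ} (hi : ¬ X G q p (f i))
    (hj : ¬ X G q p (f j)) (hne : f i ≠ f j) : Gᶜ.Adj (f (i + 1)) (f (j + 1)) := by
  obtain ⟨d, t, d1, d2, e⟩ := h.win hne
  have e1 : f j = f (i + d) := by rw [← e, h.cy.perm]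
  have e2 : f (j + 1) = f (i + d + 1) := by
    rw [← e, show j + t * r + 1 = j + 1 + t * r by ring, h.cy.perm]
  rw [e2]
  by_contra hcon
  have hred := red (h.cy.inj (i + 1) (i + d + 1) (by omega) (by omega)) hcon
  have a1 := h.cy.arc (i + 1) (d - 1)
  have a2 := h.cy.arc (i + d + 1) (r - d - 1)
  rw [show i + d + 1 + ((r - d - 1 : ℕ) : ℤ) = i + r by omega, h.cy.per] at a2
  rw [show i + 1 + ((d - 1 : ℕ) : ℤ) = i + d by omega, ← e1] at a1
  have := (a2.rev.join hred.symm a1).eqv (T := sg f 1 0 r) (by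
    rw [← sg1_all h.cy (i + 1), show d - 1 + 1 = d by omega, show r - d - 1 + 1 = r - d by omega]
    conv_rhs => rw [show r = d + (r - d) by omega, sg_add]
    rw [add_comm, show i + 1 + 1 * (d : ℤ) = i + d + 1 by ring])
  exact (h.cf.f2 C this).elim hi hj

theorem Cp.cliqueM (C : Ctx G m) (h : Cp G m r f Q q p) {i j : ℤ} (hi : ¬ X G q p (f i))
    (hj : ¬ X G q p (f j)) (hne : f i ≠ f j) : Gᶜ.Adj (f (i - 1)) (f (j - 1)) := by
  obtain ⟨d, t, d1, d2, e⟩ := h.win hne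
  have e1 : f j = f (i + d) := by rw [← e, h.cy.perm]
  have e2 : f (j - 1) = f (i + d - 1) := by
    rw [← e, show j + t * r - 1 = j - 1 + t * r by ring, h.cy.perm]
  rw [e2]
  by_contra hcon
  have hred := red (h.cy.inj (i - 1) (i + d - 1) (by omega) (by omega)) hcon
  have a1 := h.cy.arc i (d - 1)
  have a2 := h.cy.arc (i + d) (r - d - 1)
  rw [show i + d + ((r - d - 1 : ℕ) : ℤ) = i - 1 + r by omega, h.cy.per] at a2
  rw [show i + ((d - 1 : ℕ) : ℤ) = i + d - 1 by omega] at a1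
  have := (a1.join hred.symm a2.rev).eqv (T := sg f 1 0 r) (by
    rw [← sg1_all h.cy i, show d - 1 + 1 = d by omega, show r - d - 1 + 1 = r - d by omega]
    conv_rhs => rw [show r = d + (r - d) by omega, sg_add]
    rw [show i + 1 * (d : ℤ) = i + d by ring])
  rw [← e1] at this
  exact (h.cf.f2 C this).elim hi hj

def SS (G : SimpleGraph V) (f : ℤ → V) (q p : V) (x : V) : Prop :=
  ∃ i, x = f (i + 1) ∧ ¬ X G q p (f i)
def TT (G : SimpleGraph V) (f : ℤ → V) (q p : V) (x : V) : Prop :=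
  ∃ i, x = f (i - 1) ∧ ¬ X G q p (f i)

theorem Cp.hS (C : Ctx G m) (h : Cp G m r f Q q p) (x y : V) (hx : SS G f q p x)
    (hy : SS G f q p y) (hne : x ≠ y) : Gᶜ.Adj x y := by
  obtain ⟨i, rfl, hi⟩ := hx
  obtain ⟨j, rfl, hj⟩ := hy
  refine h.cliqueP C hi hj (fun e => hne ?_)
  obtain ⟨t, rfl⟩ := h.cy.eq_dvd e
  rw [show i + t * r + 1 = i + 1 + t * r by ring, h.cy.perm]

theorem Cp.hT (C : Ctx G m) (h : Cp G m r f Q q p) (x y : V) (hx : TT G f q p x)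
    (hy : TT G f q p y) (hne : x ≠ y) : Gᶜ.Adj x y := by
  obtain ⟨i, rfl, hi⟩ := hx
  obtain ⟨j, rfl, hj⟩ := hy
  refine h.cliqueM C hi hj (fun e => hne ?_)
  obtain ⟨t, rfl⟩ := h.cy.eq_dvd e
  rw [show i + t * r - 1 = i - 1 + t * r by ring, h.cy.perm]

theorem Cp.SX (C : Ctx G m) (h : Cp G m r f Q q p) {x : V} (hx : SS G f q p x) : X G q p x := by
  obtain ⟨i, rfl, hi⟩ := hx
  exact (h.consX C i).resolve_left hi

theorem Cp.TX (C : Ctx G m) (h : Cp G m r f Q q p) {x : V} (hx : TT G f q p x) : X G q p x := by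
  obtain ⟨i, rfl, hi⟩ := hx
  have := h.consX C (i - 1)
  rw [show i - 1 + 1 = i by ring] at this
  exact this.resolve_right hi

theorem Cp.step (C : Ctx G m) (h : Cp G m r f Q q p) (i : ℤ) :
    Gᶜ.Adj (f i) (f (i + 2)) ∨ (TT G f q p (f i) ∧ SS G f q p (f (i + 2))) := by
  by_cases hX : X G q p (f (i + 1))
  · left
    have := h.d2 C hX
    rwa [show i + 1 - 1 = i by ring, show i + 1 + 1 = i + 2 by ring] at this
  · right
    exact ⟨⟨i + 1, by congr 1; ring, hX⟩, ⟨i + 1, by congr 1; ring, hX⟩⟩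

/-- general use of the sequence lemma: start with HP S1 a (f b0), S (end) known -/
theorem Cp.seq1 (C : Ctx G m) (h : Cp G m r f Q q p) (S1 : Multiset V) (a : V) (b0 : ℤ)
    (h1 : HP Gᶜ S1 a (f b0)) (n : ℕ)
    (hd : ∀ i j : ℕ, i < j → j ≤ n → f (b0 + 2 * i) ≠ f (b0 + 2 * j))
    (hT : TT G f q p (f (b0 + 2 * n))) :
    ∃ b, HP Gᶜ (S1 + sg f 2 (b0 + 2) n) a b ∧ X G q p b := by
  rcases seq_lemma (B := Gᶜ) f 2 (SS G f q p) (TT G f q p) (h.hS C) (h.hT C) S1 a b0 h1 n hd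
    (fun j _ => h.step C _) with hA | ⟨n1, n2, hn, hB1, hB2, hB3, hB4⟩
  · exact ⟨_, hA, h.TX C hT⟩
  · refine ⟨_, (hB1.join (h.hT C _ _ hB2 hT (hd n1 n (by omega) le_rfl)) hB4.rev).eqv ?_, h.SX C hB3⟩
    rw [hn, show n1 + n2 + 1 = n1 + (n2 + 1) by ring, sg_add _ _ _ n1 (n2 + 1),
      show b0 + 2 + 2 * (n1 : ℤ) = b0 + 2 * n1 + 2 by ring, add_assoc]

theorem Cp.seq2 (C : Ctx G m) (h : Cp G m r f Q q p) (b0 : ℤ) (n : ℕ)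
    (hd : ∀ i j : ℕ, i < j → j ≤ n → f (b0 + 2 * i) ≠ f (b0 + 2 * j))
    (hS : SS G f q p (f b0)) :
    ∃ b, HP Gᶜ (sg f 2 b0 (n + 1)) (f (b0 + 2 * n)) b := by
  have e : sg f 2 b0 (n + 1) = {f b0} + sg f 2 (b0 + 2) n := rfl
  rw [e]
  rcases seq_lemma (B := Gᶜ) f 2 (SS G f q p) (TT G f q p) (h.hS C) (h.hT C) {f b0} (f b0) b0
    (HP.single _) n hd
    (fun j _ => h.step C _) with hA | ⟨n1, n2, hn, hB1, hB2, hB3, hB4⟩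
  · exact ⟨_, hA.rev⟩
  · have hne : f (b0 + 2 * n1 + 2) ≠ f b0 := by
      have := hd 0 (n1 + 1) (by omega) (by omega)
      intro e
      apply this
      rw [show b0 + 2 * ((n1 + 1 : ℕ) : ℤ) = b0 + 2 * n1 + 2 by push_cast; ring, e]
      simp
    refine ⟨_, (hB4.rev.join (h.hS C _ _ hB3 hS hne) hB1).eqv ?_⟩
    rw [hn, show n1 + n2 + 1 = n1 + (n2 + 1) by ring, sg_add _ _ _ n1 (n2 + 1),
      show b0 + 2 + 2 * (n1 : ℤ) = b0 + 2 * n1 + 2 by ring]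
    abel

theorem Cp.even_r (C : Ctx G m) (h : Cp G m r f Q q p) : ∃ k, r = 2 * k := by
  rcases Nat.even_or_odd' r with ⟨k, hk | hk⟩
  · exact ⟨k, hk⟩
  exfalso
  have hd : ∀ (b0 : ℤ) (i j : ℕ), i < j → j ≤ 2 * k → f (b0 + 2 * i) ≠ f (b0 + 2 * j) := by
    intro b0 i j hij hj e
    obtain ⟨t, ht⟩ := h.cy.eq_dvd e
    have h2 : 2 * ((j : ℤ) - i) = t * (2 * k + 1) := by rw [hk] at ht; push_cast at ht; linarith
    have ht2 : Even t := by
      by_contra ho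
      rw [Int.not_even_iff_odd] at ho
      have h3 : Odd (t * (2 * (k : ℤ) + 1)) := ho.mul ⟨k, rfl⟩
      rw [← h2] at h3
      exact (Int.not_even_iff_odd.2 h3) (even_two_mul _)
    obtain ⟨s, rfl⟩ := ht2
    have h4 : (j : ℤ) - i = s * (2 * k + 1) := by linarith
    have : s ≤ 0 ∨ 1 ≤ s := by omega
    rcases this with h5 | h5
    · nlinarith
    · nlinarith
  by_cases hY : ∃ i, ¬ X G q p (f i)
  · obtain ⟨i, hi⟩ := hY
    obtain ⟨b, hb, hXb⟩ := h.seq1 C {f (i + 1)} (f (i + 1)) (i + 1) (HP.single _) (2 * k)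
      (hd (i + 1)) (by
        refine ⟨i, ?_, hi⟩
        rw [← h.cy.perm (i - 1) 2, hk]
        congr 1; push_cast; ring)
    have e : {f (i + 1)} + sg f 2 (i + 1 + 2) (2 * k) = sg f 1 0 r := by
      rw [← sg1_all h.cy (i + 1), hk, ← sg2_odd (hk ▸ h.cy)]
      rfl
    rw [e] at hb
    have hX1 : X G q p (f (i + 1)) := h.SX C ⟨i, rfl, hi⟩
    exact h.cf.l4 C hb hX1.1 hXb.2 HC.zero (by simp)
  · push Not at hY
    have hb := sg_chain (G := Gᶜ) f 2 0 (2 * k) (fun j _ => by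
      have := h.d2 C (hY (0 + 2 * j + 1))
      rwa [show (0 : ℤ) + 2 * j + 1 - 1 = 0 + 2 * j by ring,
        show (0 : ℤ) + 2 * j + 1 + 1 = 0 + 2 * j + 2 by ring] at this)
    rw [sg2_odd (hk ▸ h.cy), ← hk] at hb
    exact h.cf.l4 C hb (hY _).1 (hY _).2 HC.zero (by simp)

theorem Cp.ne2 {k : ℕ} (h : Cp G m (2 * k) f Q q p) (b0 : ℤ) (i j : ℕ) (hij : i < j)
    (hj : j ≤ k - 1) : f (b0 + 2 * i) ≠ f (b0 + 2 * j) := by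
  have := h.cy.r4
  exact h.cy.inj _ _ (by omega) (by push_cast; omega)

theorem Cp.half {k : ℕ} (C : Ctx G m) (h : Cp G m (2 * k) f Q q p) {i : ℤ}
    (hi : ¬ X G q p (f i)) : (∃ b, HP Gᶜ (sg f 2 (i + 1) k) (f (i + 1)) b ∧ X G q p b) ∧
      ∃ b, HP Gᶜ (sg f 2 (i + 1) k) (f (i - 1)) b := by
  have hr := h.cy.r4
  obtain ⟨n, rfl⟩ : ∃ n, k = n + 1 := ⟨k - 1, by omega⟩
  have e : f (i + 1 + 2 * n) = f (i - 1) := by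
    rw [← h.cy.per (i - 1)]; congr 1; push_cast; ring
  constructor
  · exact h.seq1 C {f (i + 1)} (f (i + 1)) (i + 1) (HP.single _) n
      (fun i' j h1 h2 => h.ne2 _ _ _ h1 (by omega)) ⟨i, e, hi⟩
  · have := h.seq2 C (i + 1) n (fun i' j h1 h2 => h.ne2 _ _ _ h1 (by omega)) ⟨i, rfl, hi⟩
    rwa [e] at this

/-- the parity statement -/
theorem Cp.par {k : ℕ} (C : Ctx G m) (h : Cp G m (2 * k) f Q q p) {i : ℤ} (t : ℤ)
    (hi : ¬ X G q p (f i)) : X G q p (f (i + 2 * t + 1)) := by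
  by_contra hj
  obtain ⟨⟨b, hb, hXb⟩, -⟩ := h.half C hi
  obtain ⟨⟨c, hc, hXc⟩, -⟩ := h.half C hj
  have hne : f (i + 1) ≠ f (i + 2 * t + 1 + 1) := by
    intro e
    obtain ⟨s, hs⟩ := h.cy.eq_dvd e
    push_cast at hs
    have : 2 * (t - s * k) = -1 := by linarith
    omega
  have hadj := h.cliqueP C hi hj (fun e => by
    obtain ⟨s, hs⟩ := h.cy.eq_dvd e
    push_cast at hs
    have : 2 * (t - s * k) = -1 := by linarith
    omega)
  have hh := hb.rev.join hadj hc
  refine h.cf.l4 C hh hXb.1 hXc.2 HC.zero ?_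
  rw [← sg1_all h.cy (i + 1), sg_split2, show i + 2 * t + 1 + 1 = i + 1 + 1 + 2 * t by ring,
    sg2_all h.cy]
  simp
end

section
variable [Fintype V]

structure Ce (G : SimpleGraph V) (m k : ℕ) (f : ℤ → V) (Q : Multiset V) (q p : V) : Prop where
  cp : Cp G m (2 * k) f Q q p
  hE : ∀ i, X G q p (f (2 * i))

variable {G : SimpleGraph V} {m k : ℕ} {f : ℤ → V} {Q : Multiset V} {q p : V}

theorem Ce.symm (h : Ce G m k f Q q p) : Ce G m k f Q p q := ⟨h.cp.symm, fun i => (h.hE i).symm⟩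

theorem Ce.k2 (h : Ce G m k f Q q p) : 2 ≤ k := by have := h.cp.cy.r4; omega

theorem Ce.Eeq (h : Ce G m k f Q q p) (i : ℤ) : sg f 2 (2 * i) k = sg f 2 0 k := by
  have := sg2_all h.cp.cy 0 i
  rwa [zero_add] at this

theorem Ce.Oeq (h : Ce G m k f Q q p) (i : ℤ) : sg f 2 (2 * i + 1) k = sg f 2 1 k := by
  have := sg2_all h.cp.cy 1 i
  rwa [add_comm] at this

theorem Ce.Req (_h : Ce G m k f Q q p) : sg f 1 0 (2 * k) = sg f 2 0 k + sg f 2 1 k := by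
  have := sg_split2 f 0 k
  rwa [zero_add] at this

theorem Ce.och (C : Ctx G m) (h : Ce G m k f Q q p) (i : ℤ) (n : ℕ) :
    HP Gᶜ (sg f 2 (2 * i + 1) (n + 1)) (f (2 * i + 1)) (f (2 * i + 1 + 2 * n)) := by
  refine sg_chain f 2 _ n (fun j _ => ?_)
  have := h.cp.d2 C (h.hE (i + j + 1))
  rwa [show 2 * (i + j + 1) - 1 = 2 * i + 1 + 2 * (j : ℤ) by ring,
    show 2 * (i + j + 1) + 1 = 2 * i + 1 + 2 * (j : ℤ) + 2 by ring] at this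

theorem Ce.oc (C : Ctx G m) (h : Ce G m k f Q q p) (i : ℤ) :
    HP Gᶜ (sg f 2 1 k) (f (2 * i + 1)) (f (2 * i - 1)) := by
  have h2 := h.k2
  have := h.och C i (k - 1)
  rw [show k - 1 + 1 = k by omega, h.Oeq] at this
  rwa [← h.cp.cy.per (2 * i - 1),
    show 2 * i - 1 + ((2 * k : ℕ) : ℤ) = 2 * i + 1 + 2 * ((k - 1 : ℕ) : ℤ) by omega]

theorem Cf.endW {R : Multiset V} (C : Ctx G m) (h : Cf G m R Q q p) {I R' : Multiset V} {s t : V}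
    (hI : HP Gᶜ I s t) (hs : X G q p s) (hR : HC G R') (e : R = I + R') :
    G.Adj q t ∧ G.Adj p t := by
  have ht : t ∈ R := by rw [e]; exact Multiset.mem_add.2 (Or.inl hI.right)
  constructor
  · by_contra hc
    exact h.symm.l4 C hI hs.2 (blue (h.ne ht h.hQ.left).symm hc) hR e
  · by_contra hc
    exact h.l4 C hI hs.1 (blue (h.ne ht h.hQ.right).symm hc) hR e

theorem Ce.XE (h : Ce G m k f Q q p) {e : V} (he : e ∈ sg f 2 0 k) : X G q p e := by
  rw [mem_sg] at he
  obtain ⟨j, -, rfl⟩ := he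
  rw [zero_add]; exact h.hE j

def Good (G : SimpleGraph V) (f : ℤ → V) (k : ℕ) (e : V) : Prop := ∃ b, HP Gᶜ (sg f 2 0 k) e b

theorem Ce.g0 (C : Ctx G m) (h : Ce G m k f Q q p) {e : V} (he : Good G f k e) (i : ℤ)
    (ho : Gᶜ.Adj e (f (2 * i + 1))) : (G.Adj q (f (2 * i - 1)) ∧ G.Adj p (f (2 * i - 1))) ∧
      (G.Adj q (f (2 * i + 3)) ∧ G.Adj p (f (2 * i + 3))) := by
  obtain ⟨b, hb⟩ := he
  have hX := h.XE hb.right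
  constructor
  · exact h.cp.cf.endW C (hb.rev.join ho (h.oc C i)) hX HC.zero (by rw [h.Req]; simp)
  · have := h.oc C (i + 1)
    rw [show 2 * (i + 1) + 1 = 2 * i + 3 by ring, show 2 * (i + 1) - 1 = 2 * i + 1 by ring] at this
    exact h.cp.cf.endW C (hb.rev.join ho this.rev) hX HC.zero (by rw [h.Req]; simp)

theorem Ce.g0' (C : Ctx G m) (h : Ce G m k f Q q p) {e : V} (he : Good G f k e) (i : ℤ)
    (ho : Gᶜ.Adj e (f (2 * i + 1))) : (G.Adj q (f (2 * i - 3)) ∧ G.Adj p (f (2 * i - 3))) ∧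
      (G.Adj q (f (2 * i + 5)) ∧ G.Adj p (f (2 * i + 5))) := by
  have h2 := h.k2
  obtain ⟨b, hb⟩ := he
  have hX := h.XE hb.right
  obtain ⟨n, rfl⟩ : ∃ n, k = n + 2 := ⟨k - 2, by omega⟩
  constructor
  · have hc := h.och C i n
    refine h.cp.cf.endW C (t := f (2 * i - 3)) (R' := {f (2 * i - 1)})
      (I := sg f 2 0 (n + 2) + sg f 2 (2 * i + 1) (n + 1)) ?_ hX (HC.one _) ?_
    · have e1 : f (2 * i - 3) = f (2 * i + 1 + 2 * n) := by
        rw [← h.cp.cy.per]; congr 1; push_cast; ring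
      rw [e1]
      exact hb.rev.join ho hc
    · have e2 : f (2 * i - 1) = f (2 * i + 1 + 2 * ((n + 1 : ℕ) : ℤ)) := by
        rw [← h.cp.cy.per (2 * i - 1)]; congr 1; push_cast; ring
      rw [h.Req, ← h.Oeq i, sg_last _ _ (2 * i + 1) (n + 1), e2]; abel
  · have hc := h.och C (i + 2) n
    refine h.cp.cf.endW C (t := f (2 * i + 5)) (R' := {f (2 * i + 3)})
      (I := sg f 2 0 (n + 2) + sg f 2 (2 * (i + 2) + 1) (n + 1)) ?_ hX (HC.one _) ?_
    · have e1 : f (2 * (i + 2) + 1 + 2 * n) = f (2 * i + 1) := by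
        rw [← h.cp.cy.per (2 * i + 1)]; congr 1; push_cast; ring
      rw [e1, show 2 * (i + 2) + 1 = 2 * i + 5 by ring] at hc
      rw [show 2 * (i + 2) + 1 = 2 * i + 5 by ring]
      exact hb.rev.join ho hc.rev
    · rw [h.Req, ← h.Oeq (i + 1), add_assoc]
      congr 1
      rw [add_comm (sg f 2 _ (n + 1)), show 2 * (i + 1) + 1 = 2 * i + 3 by ring, show 2 * (i + 2) + 1 = 2 * i + 3 + 2 by ring]
      rfl

theorem Ce.c1 (C : Ctx G m) (h : Ce G m k f Q q p) (c : ℤ) (h1 : G.Adj q (f (2 * c - 1)))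
    (h2 : G.Adj q (f (2 * c + 1))) {Q' : Multiset V} {q2 : V} (eQ : Q = {q} + Q')
    (_hq : Gᶜ.Adj q q2) (hQ' : HP Gᶜ Q' q2 p) : G.Adj q2 (f (2 * c)) ∧
      ∀ j, f (2 * j) ≠ f (2 * c) → Gᶜ.Adj q2 (f (2 * j)) ∧ Gᶜ.Adj (f (2 * c)) (f (2 * j)) := by
  classical
  have hk := h.k2
  have hcy := h.cp.cy
  let g : ℤ → V := fun j => if ((2 * k : ℕ) : ℤ) ∣ j - 2 * c then q else f j
  have gq : ∀ j, (((2 * k : ℕ) : ℤ) ∣ j - 2 * c) → g j = q := fun j hj => if_pos hj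
  have gf : ∀ j, (¬ ((2 * k : ℕ) : ℤ) ∣ j - 2 * c) → g j = f j := fun j hj => if_neg hj
  have hqn : ∀ j, q ≠ f j := fun j => (h.cp.cf.ne (h.cp.mem j) h.cp.cf.hQ.left).symm
  have nd : ∀ j : ℤ, 2 * c < j → j < 2 * c + 2 * k → ¬ ((2 * k : ℕ) : ℤ) ∣ j - 2 * c := by
    intro j h3 h4 h5
    have := Int.le_of_dvd (by omega) h5
    push_cast at this
    omega
  have gcy : Cyc G (2 * k) g := by
    refine ⟨hcy.r4, ?_, ?_, ?_⟩
    · intro i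
      by_cases hi : ((2 * k : ℕ) : ℤ) ∣ i - 2 * c
      · rw [gq i hi, gq]
        rw [show i + ((2 * k : ℕ) : ℤ) - 2 * c = i - 2 * c + ((2 * k : ℕ) : ℤ) by ring]
        exact dvd_add_self_right.2 hi
      · rw [gf i hi, gf, hcy.per]
        rw [show i + ((2 * k : ℕ) : ℤ) - 2 * c = i - 2 * c + ((2 * k : ℕ) : ℤ) by ring,
          dvd_add_self_right]
        exact hi
    · intro i j hij hj
      by_cases hi : ((2 * k : ℕ) : ℤ) ∣ i - 2 * c <;> by_cases hj' : ((2 * k : ℕ) : ℤ) ∣ j - 2 * c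
      · exfalso
        have h5 := dvd_sub hj' hi
        rw [show j - 2 * c - (i - 2 * c) = j - i by ring] at h5
        have := Int.le_of_dvd (by omega) h5
        omega
      · rw [gq i hi, gf j hj']; exact hqn _
      · rw [gf i hi, gq j hj']; exact (hqn _).symm
      · rw [gf i hi, gf j hj']; exact hcy.inj _ _ hij hj
    · intro i
      by_cases hi : ((2 * k : ℕ) : ℤ) ∣ i - 2 * c <;> by_cases hj' : ((2 * k : ℕ) : ℤ) ∣ i + 1 - 2 * c
      · exfalso
        have h5 := dvd_sub hj' hi
        rw [show i + 1 - 2 * c - (i - 2 * c) = 1 by ring] at h5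
        have := Int.le_of_dvd (by omega) h5
        omega
      · rw [gq i hi, gf _ hj']
        obtain ⟨t, ht⟩ := hi
        rw [show i + 1 = 2 * c + 1 + t * ((2 * k : ℕ) : ℤ) by linarith, hcy.perm]
        exact h2
      · rw [gf i hi, gq _ hj']
        obtain ⟨t, ht⟩ := hj'
        rw [show i = 2 * c - 1 + t * ((2 * k : ℕ) : ℤ) by linarith, hcy.perm]
        exact h1.symm
      · rw [gf i hi, gf _ hj']; exact hcy.adj _
  obtain ⟨n, hn⟩ : ∃ n, 2 * k = n + 1 := ⟨2 * k - 1, by omega⟩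
  have eg : sg g 1 0 (2 * k) = {q} + sg f 1 (2 * c + 1) n := by
    rw [← sg1_all gcy (2 * c), hn]
    have : sg g 1 (2 * c + 1) n = sg f 1 (2 * c + 1) n :=
      sg_congr (fun j hj => gf _ (nd _ (by omega) (by omega)))
    rw [← this, ← gq (2 * c) (by simp)]
    rfl
  have ef : sg f 1 0 (2 * k) = {f (2 * c)} + sg f 1 (2 * c + 1) n := by
    rw [← sg1_all hcy (2 * c), hn]; rfl
  have hcp : Cp G m (2 * k) g (Q' + {f (2 * c)}) q2 (f (2 * c)) := by
    refine ⟨⟨?_, hQ'.snoc (h.hE c).2, ?_, ?_⟩, gcy⟩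
    · have := gcy.arc 0 n
      rw [← hn] at this
      refine this.close ?_
      have h5 := gcy.adj n
      rw [show (n : ℤ) + 1 = 0 + ((2 * k : ℕ) : ℤ) by omega, gcy.per] at h5
      rwa [zero_add]
    · rw [← h.cp.cf.hU, eg, ef, eQ]; abel
    · rw [← h.cp.cf.hc, eQ]; simp [add_comm]
  have hg1 : g (2 * c - 1) = f (2 * c - 1) := by
    rw [← gcy.per, ← hcy.per]
    exact gf _ (nd _ (by omega) (by push_cast; omega))
  refine ⟨hcp.cf.qp C, fun j hj => ?_⟩
  have := hcp.par C (i := 2 * c - 1) (j - c) (by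
    rw [hg1]
    intro hx
    have := hcy.adj (2 * c - 1)
    rw [show 2 * c - 1 + 1 = 2 * c by ring] at this
    exact notboth this.symm hx.2)
  rw [show 2 * c - 1 + 2 * (j - c) + 1 = 2 * j by ring, gf (2 * j)] at this
  · exact this
  · rintro ⟨t, ht⟩
    apply hj
    rw [show 2 * j = 2 * c + t * ((2 * k : ℕ) : ℤ) by linarith, hcy.perm]

theorem Ce.cc1 (C : Ctx G m) (h : Ce G m k f Q q p) (c d : ℤ) (h1 : G.Adj q (f (2 * c - 1)))
    (h2 : G.Adj q (f (2 * c + 1))) (h3 : G.Adj q (f (2 * d - 1)))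
    (h4 : G.Adj q (f (2 * d + 1))) (hne : f (2 * c) ≠ f (2 * d)) : False := by
  have hm := h.cp.cf.m3 C
  obtain ⟨T, q2, e1, e2, e3⟩ := h.cp.cf.hQ.dec2 (by rw [h.cp.cf.hc]; omega)
  have a := (h.c1 C c h1 h2 e1 e2 e3).1
  have b := ((h.c1 C d h3 h4 e1 e2 e3).2 c hne).1
  exact notboth a b

theorem Ce.cc2 (C : Ctx G m) (h : Ce G m k f Q q p) (c d : ℤ) (h1 : G.Adj q (f (2 * c - 1)))
    (h2 : G.Adj q (f (2 * c + 1))) (h3 : G.Adj p (f (2 * d - 1)))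
    (h4 : G.Adj p (f (2 * d + 1))) (hne : f (2 * c) ≠ f (2 * d)) : False := by
  have hcy := h.cp.cy
  obtain ⟨M, a, b, e1, e2, e3, e4⟩ := h.cp.cf.mid C
  have A := ((h.c1 C c h1 h2 (Q' := M + {p}) (by rw [e1, add_assoc]) e2 (e4.snoc e3)).2 d hne.symm)
  have B := ((h.symm.c1 C d h3 h4 (Q' := {q} + M) (by rw [e1]; abel) e3.symm
    ((HP.cons e2 e4).rev)).2 c hne)
  obtain ⟨w, t, w1, w2, hw⟩ := h.cp.win hne
  obtain ⟨u, hu⟩ : ∃ u : ℕ, w = 2 * u + 2 := by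
    have : (2:ℤ) * (d + t * k - c) = w := by push_cast at hw; linarith
    exact ⟨(d + t * k - c).toNat - 1, by omega⟩
  have hdc : ∀ z, f (2 * d + z) = f (2 * c + w + z) := by
    intro z; rw [← hw, show 2 * d + t * ((2 * k : ℕ) : ℤ) + z = 2 * d + z + t * ((2 * k : ℕ) : ℤ) by ring,
      hcy.perm]
  have a1 := hcy.arc (2 * c + 1) (2 * u)
  obtain ⟨s, hs⟩ : ∃ s : ℕ, 2 * k = w + s + 2 := ⟨2 * k - w - 2, by omega⟩
  have a2 := hcy.arc (2 * c + w + 1) s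
  rw [show 2 * c + 1 + ((2 * u : ℕ) : ℤ) = 2 * c + w + (-1) by rw [hu]; push_cast; ring, ← hdc] at a1
  rw [show 2 * c + w + 1 + (s : ℤ) = 2 * c - 1 + ((2 * k : ℕ) : ℤ) by rw [hs]; push_cast; ring, hcy.per,
    ← hdc] at a2
  have hred : HC G ({q} + sg f 1 (2 * c + 1) (2 * u + 1) + {p} + sg f 1 (2 * c + w + 1) (s + 1)) :=
    HP.close (((HP.cons h2 a1).snoc h3.symm).join h4 a2) h1.symm
  have hblue : HC Gᶜ ({f (2 * c)} + ({f (2 * d)} + M)) :=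
    HP.close (HP.cons A.2 (HP.cons A.1.symm e4)) B.1
  refine C.ns ⟨_, _, hred, hblue, ?_⟩
  rw [← h.cp.cf.hU, e1, ← sg1_all hcy (2 * c), show 2 * k = 1 + ((2 * u + 1) + (1 + (s + 1))) by omega,
    sg_add _ _ _ 1, sg_add _ _ _ (2 * u + 1), sg_add _ _ _ 1 (s + 1), sg_one, sg_one]
  have e5 : f (2 * d) = f (2 * c + w) := by have := hdc 0; simpa using this
  rw [e5, show 2 * c + 1 * ((1 : ℕ) : ℤ) = 2 * c + 1 by simp,
    show 2 * c + 1 + 1 * ((2 * u + 1 : ℕ) : ℤ) = 2 * c + w by omega,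
    show 2 * c + w + 1 * ((1 : ℕ) : ℤ) = 2 * c + w + 1 by omega]
  abel
end

section
variable [Fintype V]
variable {G : SimpleGraph V} {m k : ℕ} {f : ℤ → V} {Q : Multiset V} {q p : V}

theorem Ce.ne_eo (h : Ce G m k f Q q p) (i j : ℤ) : f (2 * i) ≠ f (2 * j + 1) := by
  intro e
  obtain ⟨t, ht⟩ := h.cp.cy.eq_dvd e
  push_cast at ht
  have : 2 * (i + t * k - j) = 1 := by linarith
  omega

theorem Ce.noX (C : Ctx G m) (h : Ce G m k f Q q p) (i : ℤ)
    (h1 : G.Adj q (f (2 * i - 1))) (h3 : G.Adj q (f (2 * i + 3))) : Gᶜ.Adj q (f (2 * i + 1)) := by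
  by_contra hc
  have hr := red (h.cp.cf.ne (h.cp.mem _) h.cp.cf.hQ.left).symm hc
  refine h.cc1 C i (i + 1) h1 hr ?_ ?_ ?_
  · rwa [show 2 * (i + 1) - 1 = 2 * i + 1 by ring]
  · rwa [show 2 * (i + 1) + 1 = 2 * i + 3 by ring]
  · have := h.k2
    exact h.cp.cy.inj _ _ (by omega) (by push_cast; omega)

theorem Ce.g1 (C : Ctx G m) (h : Ce G m k f Q q p) {e : V} (he : Good G f k e) (i : ℤ) :
    ¬ Gᶜ.Adj e (f (2 * i + 1)) := by
  intro ho
  have hk := h.k2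
  have hcy := h.cp.cy
  obtain ⟨⟨w1, w2⟩, w3, w4⟩ := h.g0 C he i ho
  obtain ⟨⟨v1, v2⟩, v3, v4⟩ := h.g0' C he i ho
  by_cases hne : f (2 * (i - 1)) = f (2 * (i + 2))
  · obtain ⟨t, ht⟩ := hcy.eq_dvd hne
    have hk3 : k = 3 := by
      push_cast at ht
      have h3 : (3 : ℤ) = t * k := by linarith
      have hd : (k : ℤ) ∣ 3 := ⟨t, by linarith⟩
      have hd' : k ∣ 3 := by exact_mod_cast hd
      rcases (Nat.dvd_prime Nat.prime_three).1 hd' with h4 | h4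
      · omega
      · exact h4
    subst hk3
    have xo1 := h.noX C i w1 w3
    have xo2 := h.symm.noX C i w2 w4
    have per : ∀ j, f (j + 6) = f j := fun j => by have := hcy.per j; simpa using this
    -- locate e
    have hem : e = f (2 * i + 4) := by
      obtain ⟨b, hb⟩ := he
      have := hb.left
      rw [← h.Eeq i, mem_sg] at this
      obtain ⟨j, hj, rfl⟩ := this
      interval_cases j
      · exfalso
        have := hcy.adj (2 * i)
        simp at ho
        exact ho.2 this
      · exfalso
        have := hcy.adj (2 * i + 1)
        rw [show 2 * i + 1 + 1 = 2 * i + 2 by ring] at this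
        simp at ho
        exact ho.2 this.symm
      · norm_num
    subst hem
    have hnX : ¬ X G q p (f (2 * i + 3)) := fun hx => notboth w3 hx.1
    obtain ⟨-, b, hb⟩ := h.cp.half C hnX
    rw [show 2 * i + 3 + 1 = 2 * (i + 2) by ring, h.Eeq, show 2 * i + 3 - 1 = 2 * i + 2 by ring] at hb
    have hw' : G.Adj (f (2 * i + 2)) (f (2 * i + 5)) := by
      refine red (hcy.inj _ _ (by omega) (by push_cast; omega)) (fun hc => ?_)
      have := (h.g0 C ⟨b, hb⟩ (i + 2) (by rwa [show 2 * (i + 2) + 1 = 2 * i + 5 by ring])).2.1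
      rw [show 2 * (i + 2) + 3 = 2 * i + 1 + 6 by ring, per] at this
      exact notboth this xo1
    have hm := h.cp.cf.m3 C
    obtain ⟨T, q2, e1, e2, e3⟩ := h.cp.cf.hQ.dec2 (by rw [h.cp.cf.hc]; omega)
    have hc1 := (h.c1 C (i + 2) (by rwa [show 2 * (i + 2) - 1 = 2 * i + 3 by ring])
      (by rwa [show 2 * (i + 2) + 1 = 2 * i + 5 by ring]) e1 e2 e3).2 i
      (hcy.inj _ _ (by omega) (by push_cast; omega))
    rw [show 2 * (i + 2) = 2 * i + 4 by ring] at hc1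
    have a23 := hcy.adj (2 * i + 2)
    rw [show 2 * i + 2 + 1 = 2 * i + 3 by ring] at a23
    have hred : HC G ({f (2 * i + 2)} + ({f (2 * i + 3)} + ({q} + {f (2 * i + 5)}))) :=
      (HP.cons a23 (HP.cons w3.symm (HP.cons v3 (HP.single _)))).close hw'.symm
    have hblue : HC Gᶜ (T + {f (2 * i + 1)} + {f (2 * i + 4)} + {f (2 * i)}) :=
      (((e3.snoc xo2).snoc ho.symm).snoc hc1.2).close hc1.1.symm
    refine C.ns ⟨_, _, hred, hblue, ?_⟩
    rw [← h.cp.cf.hU, e1, ← sg1_all hcy (2 * i)]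
    have : sg f 1 (2 * i) (2 * 3) = {f (2 * i)} + ({f (2 * i + 1)} + ({f (2 * i + 2)} +
        ({f (2 * i + 3)} + ({f (2 * i + 4)} + ({f (2 * i + 5)} + 0))))) := by
      simp only [sg]
      rw [show 2 * i + 1 + 1 = 2 * i + 2 by ring, show 2 * i + 2 + 1 = 2 * i + 3 by ring,
        show 2 * i + 3 + 1 = 2 * i + 4 by ring, show 2 * i + 4 + 1 = 2 * i + 5 by ring]
    rw [this]
    abel
  · refine h.cc1 C (i - 1) (i + 2) ?_ ?_ ?_ ?_ hne
    · rwa [show 2 * (i - 1) - 1 = 2 * i - 3 by ring]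
    · rwa [show 2 * (i - 1) + 1 = 2 * i - 1 by ring]
    · rwa [show 2 * (i + 2) - 1 = 2 * i + 3 by ring]
    · rwa [show 2 * (i + 2) + 1 = 2 * i + 5 by ring]

theorem Ce.g1' (C : Ctx G m) (h : Ce G m k f Q q p) {e : V} (he : Good G f k e) (i : ℤ) :
    G.Adj e (f (2 * i + 1)) := by
  refine red ?_ (h.g1 C he i)
  obtain ⟨b, hb⟩ := he
  have := hb.left
  rw [mem_sg] at this
  obtain ⟨j, hj, rfl⟩ := this
  rw [zero_add]
  exact h.ne_eo _ _

theorem Ce.Hgood (C : Ctx G m) (h : Ce G m k f Q q p) (i : ℤ) : Good G f k (f (2 * i)) := by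
  classical
  have hk := h.k2
  have hcy := h.cp.cy
  by_cases hY : ∀ j, X G q p (f (2 * j + 1))
  · have := sg_chain (G := Gᶜ) f 2 (2 * i) (k - 1) (fun j _ => by
      have := h.cp.d2 C (hY (i + j))
      rwa [show 2 * (i + (j:ℤ)) + 1 - 1 = 2 * i + 2 * j by ring,
        show 2 * (i + (j:ℤ)) + 1 + 1 = 2 * i + 2 * j + 2 by ring] at this)
    rw [show k - 1 + 1 = k by omega, h.Eeq] at this
    exact ⟨_, this⟩
  push Not at hY
  obtain ⟨c0, hc0⟩ := hY
  have hex : ∃ d : ℕ, ¬ X G q p (f (2 * i - d)) ∧ d < 2 * k := by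
    obtain ⟨t, t1, t2⟩ := hcy.window (2 * i - 2 * k + 1) (2 * c0 + 1)
    refine ⟨(2 * i - (2 * c0 + 1 + t * ((2 * k : ℕ) : ℤ))).toNat, ?_, by omega⟩
    rw [← hcy.perm (2 * c0 + 1) t] at hc0
    convert hc0 using 3
    push_cast at t1 t2 ⊢
    omega
  set d := Nat.find hex with hd
  obtain ⟨hd1, hd2⟩ := Nat.find_spec hex
  rw [← hd] at hd1 hd2
  have hmin : ∀ j : ℕ, j < d → X G q p (f (2 * i - j)) := by
    intro j hj
    have := Nat.find_min hex hj
    by_contra hcon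
    exact this ⟨hcon, by omega⟩
  obtain ⟨t, ht⟩ : ∃ t : ℕ, d = 2 * t + 1 := by
    rcases Nat.even_or_odd' d with ⟨t, ht | ht⟩
    · exfalso; apply hd1; rw [ht]
      have := h.hE (i - t)
      convert this using 2; push_cast; ring
    · exact ⟨t, ht⟩
  by_cases ht0 : t = 0
  · rw [ht, ht0] at hd1
    obtain ⟨⟨b, hb, -⟩, -⟩ := h.cp.half C hd1
    norm_num at hb
    rw [h.Eeq] at hb
    exact ⟨b, hb⟩
  by_cases hX1 : X G q p (f (2 * i + 1))
  swap
  · obtain ⟨-, b, hb⟩ := h.cp.half C hX1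
    rw [show 2 * i + 1 + 1 = 2 * (i + 1) by ring, h.Eeq, show 2 * i + 1 - 1 = 2 * i by ring] at hb
    exact ⟨b, hb⟩
  have htk : t + 2 ≤ k := by
    by_contra hcon
    apply hd1
    rw [← hcy.per]
    convert hX1 using 2
    push_cast; omega
  obtain ⟨n, hn⟩ : ∃ n, k = t + 2 + n := ⟨k - t - 2, by omega⟩
  -- c = 2*i - 2t - 1
  set c : ℤ := 2 * (i - t - 1) + 1 with hc
  have hcd : 2 * i - (d : ℤ) = c := by rw [ht, hc]; push_cast; ring
  rw [hcd] at hd1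
  have hmin' : ∀ j : ℕ, j ≤ 2 * t → X G q p (f (2 * i - j)) := fun j hj => hmin j (by omega)
  -- even chain
  have hev : HP Gᶜ (sg f 2 (c + 1) (t + 1)) (f (c + 1)) (f (2 * i)) := by
    have := sg_chain (G := Gᶜ) f 2 (c + 1) t (fun j hj => by
      have hx := hmin' (2 * (t - 1 - j) + 1) (by omega)
      have := h.cp.d2 C hx
      rwa [show 2 * i - ((2 * (t - 1 - j) + 1 : ℕ) : ℤ) - 1 = c + 1 + 2 * j by omega,
        show 2 * i - ((2 * (t - 1 - j) + 1 : ℕ) : ℤ) + 1 = c + 1 + 2 * j + 2 by omega] at this)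
    rwa [show c + 1 + 2 * (t : ℤ) = 2 * i by rw [hc]; ring] at this
  by_cases hye : Gᶜ.Adj (f c) (f (2 * i))
  · exfalso
    have hod := h.och C (i - t - 1) t
    rw [← hc, show c + 2 * (t : ℤ) = 2 * i - 1 by rw [hc]; ring] at hod
    have hI := (hod.rev.join hye hev.rev)
    obtain ⟨-, b, hb⟩ := h.cp.half C hd1
    have hgood : Good G f k (f (c - 1)) := by
      rw [show c + 1 = 2 * (i - t) by rw [hc]; ring, h.Eeq] at hb
      exact ⟨b, hb⟩
    have hr := h.g1' C hgood i
    have a := hcy.arc (2 * i + 1) (2 * n + 1)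
    rw [show 2 * i + 1 + ((2 * n + 1 : ℕ) : ℤ) = c - 1 + ((2 * k : ℕ) : ℤ) by
      rw [hc, hn]; push_cast; ring, hcy.per] at a
    have hXe : X G q p (f (c + 1)) := by
      have := h.hE (i - t)
      rwa [show 2 * (i - (t : ℤ)) = c + 1 by rw [hc]; ring] at this
    have hX1' := hmin' 1 (by omega)
    refine h.cp.cf.l4 C hI hX1'.1 hXe.2 (a.close hr) ?_
    rw [← sg1_all hcy c, ← sg_split2, show 2 * k = 2 * (t + 1) + (2 * n + 1 + 1) by omega, sg_add]
    congr 2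
    push_cast; rw [hc]; ring
  · have hne : f c ≠ f (2 * i) := by rw [hc]; exact (h.ne_eo _ _).symm
    have hr := red hne hye
    have a1 := hcy.arc (c + 1) (2 * t)
    rw [show c + 1 + ((2 * t : ℕ) : ℤ) = 2 * i by rw [hc]; push_cast; ring] at a1
    have a2 := hcy.arc (2 * i + 2) (2 * n + 1)
    rw [show 2 * i + 2 + ((2 * n + 1 : ℕ) : ℤ) = c + ((2 * k : ℕ) : ℤ) by
      rw [hc, hn]; push_cast; ring, hcy.per] at a2
    have hb := h.cp.cf.f3 C hX1 (R' := _) ?_ (a1.join hr.symm a2.rev)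
    · have hS1 := hev.rev.snoc hb
      obtain ⟨b, hb', -⟩ := h.cp.seq1 C _ _ (2 * i + 2) hS1 n
        (fun i' j h1 h2 => h.cp.ne2 _ _ _ h1 (by omega)) ⟨c, by
          rw [← hcy.per (c - 1)]; congr 1; rw [hc, hn]; push_cast; ring, hd1⟩
      refine ⟨b, hb'.eqv ?_⟩
      rw [← h.Eeq (i - t), show 2 * (i - (t : ℤ)) = c + 1 by rw [hc]; ring, hn,
        show t + 2 + n = (t + 1) + (1 + n) by ring, sg_add _ _ (c + 1) (t + 1), sg_add _ _ _ 1 n, sg_one,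
        show c + 1 + 2 * ((t + 1 : ℕ) : ℤ) = 2 * i + 2 by rw [hc]; push_cast; ring,
        show 2 * i + 2 + 2 * ((1 : ℕ) : ℤ) = 2 * i + 2 + 2 by simp]
      abel
    · rw [← sg1_all hcy (c + 1), show 2 * k = (2 * t + 1) + (1 + (2 * n + 1 + 1)) by omega,
        sg_add _ _ (c + 1) (2 * t + 1), sg_add _ _ _ 1 (2 * n + 1 + 1), sg_one,
        show c + 1 + 1 * ((2 * t + 1 : ℕ) : ℤ) = 2 * i + 1 by rw [hc]; push_cast; ring,
        show 2 * i + 1 + 1 * ((1 : ℕ) : ℤ) = 2 * i + 2 by push_cast; ring]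
      abel

theorem Ce.H (C : Ctx G m) (h : Ce G m k f Q q p) (i j : ℤ) :
    G.Adj (f (2 * i)) (f (2 * j + 1)) := h.g1' C (h.Hgood C i) j
end

theorem getm {S : Multiset V} {a : V} (h : a ∈ S) : ∃ T, S = {a} + T := by
  obtain ⟨T, hT⟩ := Multiset.exists_cons_of_mem h
  exact ⟨T, by rw [hT, Multiset.singleton_add]⟩

theorem getany {S : Multiset V} (h : 1 ≤ Multiset.card S) : ∃ a T, S = {a} + T ∧ a ∈ S := by
  obtain ⟨a, ha⟩ := Multiset.card_pos_iff_exists_mem.1 h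
  obtain ⟨T, hT⟩ := getm ha
  exact ⟨a, T, hT, ha⟩

theorem clique0 {B : SimpleGraph V} (S : Multiset V) (x y : V) (hn : ({x} + S + {y}).Nodup)
    (h : ∀ u ∈ {x} + S + {y}, ∀ w ∈ {x} + S + {y}, u ≠ w → B.Adj u w) :
    HP B ({x} + S + {y}) x y := by
  induction S using Multiset.induction_on generalizing x with
  | empty =>
    refine ((HP.single x).snoc (h x (by simp) y (by simp) ?_)).eqv (by simp)
    rintro rfl
    simp at hn
  | cons z S ih =>
    have e : {x} + z ::ₘ S + {y} = {x} + ({z} + S + {y}) := by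
      rw [← Multiset.singleton_add]; abel
    rw [e] at hn h ⊢
    rw [Multiset.nodup_add] at hn
    refine HP.cons (h x (by simp) z (by simp) ?_) (ih z hn.2.1 ?_)
    · rintro rfl
      exact Multiset.disjoint_left.1 hn.2.2 (by simp) (by simp : x ∈ {x} + S + {y})
    · intro u hu w hw
      exact h u (Multiset.mem_add.2 (Or.inr hu)) w (Multiset.mem_add.2 (Or.inr hw))

theorem cliqueHP {B : SimpleGraph V} {S : Multiset V} (hn : S.Nodup)
    (h : ∀ u ∈ S, ∀ w ∈ S, u ≠ w → B.Adj u w) {a b : V} (ha : a ∈ S) (hb : b ∈ S) (hab : a ≠ b) :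
    HP B S a b := by
  obtain ⟨T, rfl⟩ := getm ha
  have hb' : b ∈ T := by
    rcases Multiset.mem_add.1 hb with h1 | h1
    · exact (hab (Multiset.mem_singleton.1 h1).symm).elim
    · exact h1
  obtain ⟨T', rfl⟩ := getm hb'
  have e : {a} + ({b} + T') = {a} + T' + {b} := by abel
  rw [e] at hn h ⊢
  exact clique0 T' a b hn h

theorem bip {B : SimpleGraph V} (n : ℕ) : ∀ (S T : Multiset V) (a b : V), Multiset.card S = n →
    Multiset.card T = n → a ∈ S → b ∈ T → (∀ x ∈ S, ∀ y ∈ T, B.Adj x y) → HP B (S + T) a b := by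
  induction n with
  | zero =>
    intro S T a b h1 h2 ha hb h
    rw [Multiset.card_eq_zero] at h1
    subst h1; simp at ha
  | succ n ih =>
    intro S T a b h1 h2 ha hb h
    obtain ⟨S', rfl⟩ := getm ha
    obtain ⟨T', rfl⟩ := getm hb
    simp at h1 h2
    have h1' : Multiset.card S' = n := by omega
    have h2' : Multiset.card T' = n := by omega
    rcases Nat.eq_zero_or_pos n with h0 | h0
    · rw [h0, Multiset.card_eq_zero] at h1' h2'
      subst h1'; subst h2'
      exact ((HP.single a).snoc (h a ha b hb)).eqv (by simp)
    · obtain ⟨a', S'', e1, ha'⟩ := getany (S := S') (by omega)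
      obtain ⟨b', T'', e2, hb'⟩ := getany (S := T') (by omega)
      have := ih S' T' a' b' h1' h2' ha' hb' (fun x hx y hy =>
        h x (Multiset.mem_add.2 (Or.inr hx)) y (Multiset.mem_add.2 (Or.inr hy)))
      refine ((HP.cons (h a ha b' (Multiset.mem_add.2 (Or.inr hb'))) this.rev).snoc
        (h a' (Multiset.mem_add.2 (Or.inr ha')) b hb)).eqv (by abel)

/-- sizes differ by one, prescribed ends -/
theorem bip2 {B : SimpleGraph V} {S T : Multiset V} {a b : V} (hc : Multiset.card S = Multiset.card T + 1)
    (ha : a ∈ S) (hb : b ∈ S) (hab : a ≠ b) (h : ∀ x ∈ S, ∀ y ∈ T, B.Adj x y) :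
    HP B (S + T) a b := by
  obtain ⟨S', rfl⟩ := getm ha
  have hb' : b ∈ S' := by
    rcases Multiset.mem_add.1 hb with h1 | h1
    · exact (hab (Multiset.mem_singleton.1 h1).symm).elim
    · exact h1
  simp at hc
  have hp : 0 < Multiset.card S' := Multiset.card_pos_iff_exists_mem.2 ⟨b, hb'⟩
  obtain ⟨y, T', e, hy⟩ := getany (S := T) (by omega)
  have := bip (B := B) (Multiset.card T) S' T b y (by omega) rfl hb' hy (fun x hx y hy =>
        h x (Multiset.mem_add.2 (Or.inr hx)) y hy)
  exact (HP.cons (h a ha y hy) this.rev).eqv (by abel)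

theorem bip1 {B : SimpleGraph V} {S T : Multiset V} (hc : Multiset.card S = Multiset.card T + 1)
    (h : ∀ x ∈ S, ∀ y ∈ T, B.Adj x y) :
    ∃ a b, a ∈ S ∧ b ∈ S ∧ HP B (S + T) a b := by
  obtain ⟨a, S', e, ha⟩ := getany (S := S) (by omega)
  rcases Nat.eq_zero_or_pos (Multiset.card T) with h0 | h0
  · rw [Multiset.card_eq_zero] at h0
    subst h0
    simp at hc
    rw [e] at hc
    simp at hc
    subst hc
    refine ⟨a, a, ha, ha, ?_⟩
    rw [e]
    exact (HP.single a).eqv (by simp)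
  · obtain ⟨y, T', e', hy⟩ := getany (S := T) (by omega)
    subst e
    simp at hc
    obtain ⟨b, S'', e, hb⟩ := getany (S := S') (by omega)
    have := bip (B := B) (Multiset.card T) S' T b y (by omega) rfl hb hy (fun x hx y hy =>
        h x (Multiset.mem_add.2 (Or.inr hx)) y hy)
    exact ⟨a, b, ha, Multiset.mem_add.2 (Or.inr hb), (HP.cons (h a ha y hy) this.rev).eqv (by abel)⟩

theorem ndne {a b : V} {T : Multiset V} (h : ({a} + T).Nodup) (hb : b ∈ T) : a ≠ b := by
  rintro rfl
  rw [Multiset.nodup_add] at h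
  exact Multiset.disjoint_left.1 h.2.2 (by simp) hb

section
variable [Fintype V]

structure Fn (G : SimpleGraph V) (m : ℕ) (E O Q : Multiset V) (q p : V) : Prop where
  cf : Cf G m (E + O) Q q p
  hX : ∀ e ∈ E, X G q p e
  EO : ∀ e ∈ E, ∀ o ∈ O, G.Adj e o
  EE : ∀ e ∈ E, ∀ e' ∈ E, e ≠ e' → Gᶜ.Adj e e'
  OO : ∀ e ∈ O, ∀ e' ∈ O, e ≠ e' → Gᶜ.Adj e e'
  hc : Multiset.card E = Multiset.card O
  h2 : 2 ≤ Multiset.card O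

variable {G : SimpleGraph V} {m k : ℕ} {f : ℤ → V} {Q E O : Multiset V} {q p : V}

theorem Fn.ndE (h : Fn G m E O Q q p) : E.Nodup := by
  have := h.cf.ndR
  rw [Multiset.nodup_add] at this; exact this.1

theorem Fn.ndO (h : Fn G m E O Q q p) : O.Nodup := by
  have := h.cf.ndR
  rw [Multiset.nodup_add] at this; exact this.2.1

theorem Fn.mE (_h : Fn G m E O Q q p) {e : V} (he : e ∈ E) : e ∈ E + O := Multiset.mem_add.2 (Or.inl he)
theorem Fn.mO (_h : Fn G m E O Q q p) {e : V} (he : e ∈ O) : e ∈ E + O := Multiset.mem_add.2 (Or.inr he)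

/-- another element -/
theorem Fn.otherE (h : Fn G m E O Q q p) {e : V} (he : e ∈ E) : ∃ e' ∈ E, e ≠ e' := by
  obtain ⟨T, hT⟩ := getm he
  have h1 := h.hc; have h2 := h.h2
  rw [hT] at h1; simp at h1
  obtain ⟨a, T', e1, ha⟩ := getany (S := T) (by omega)
  exact ⟨a, by rw [hT]; exact Multiset.mem_add.2 (Or.inr ha), ndne (hT ▸ h.ndE) ha⟩

theorem Fn.symm (h : Fn G m E O Q q p) : Fn G m E O Q p q :=
  ⟨h.cf.symm, fun e he => (h.hX e he).symm, h.EO, h.EE, h.OO, h.hc, h.h2⟩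

theorem Fn.c (C : Ctx G m) (h : Fn G m E O Q q p) {o : V} (ho : o ∈ O) (hoq : Gᶜ.Adj q o)
    (hop : Gᶜ.Adj p o) (hq : ∀ y ∈ O, y ≠ o → G.Adj q y) : False := by
  have hm := h.cf.m3 C
  have hcQ := h.cf.hc
  have hcE := h.hc
  have h2 := h.h2
  have ndE := h.ndE
  have ndO := h.ndO
  obtain ⟨O', eO⟩ := getm ho
  have cO : Multiset.card O = 1 + Multiset.card O' := by rw [eO]; simp [add_comm]
  obtain ⟨y, O2, eO', hy⟩ := getany (S := O') (by omega)
  have cO' : Multiset.card O' = 1 + Multiset.card O2 := by rw [eO']; simp [add_comm]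
  have hy' : y ∈ O := by rw [eO]; exact Multiset.mem_add.2 (Or.inr hy)
  have hyo : o ≠ y := ndne (eO ▸ ndO) hy
  have ndO' : O'.Nodup := by have := ndO; rw [eO, Multiset.nodup_add] at this; exact this.2.1
  rcases Nat.eq_zero_or_pos (Multiset.card O2) with h0 | h0
  · -- k = 2
    rw [Multiset.card_eq_zero] at h0
    subst h0
    obtain ⟨e, E', eE, he⟩ := getany (S := E) (by omega)
    have cE : Multiset.card E = 1 + Multiset.card E' := by rw [eE]; simp [add_comm]
    obtain ⟨e', E2, eE', he'⟩ := getany (S := E') (by omega)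
    have cE' : Multiset.card E' = 1 + Multiset.card E2 := by rw [eE']; simp [add_comm]
    have : E2 = 0 := by
      rw [← Multiset.card_eq_zero]
      simp at cO'; omega
    subst this
    have he'E : e' ∈ E := by rw [eE]; exact Multiset.mem_add.2 (Or.inr he')
    have hee : e ≠ e' := ndne (eE ▸ ndE) he'
    have hm3 : m ≤ 3 := by
      have := C.mn' (Q + {e}) ({o} + ({e'} + {y})) o y
        ((h.cf.hQ.snoc (h.hX e he).2).close (h.hX e he).1.symm)
        (HP.cons (h.EO e' he'E o ho).symm (HP.cons (h.EO e' he'E y hy') (HP.single y)))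
        (by rw [← h.cf.hU, eE, eE', eO, eO']; simp only [add_zero]; abel)
      simpa using this
    obtain ⟨M, a, b, e1, e2, e3, e4⟩ := h.cf.mid C
    have hM : Multiset.card M = 1 := by
      rw [e1] at hcQ; simp at hcQ; omega
    rcases e4.dec with ⟨h5, h6⟩ | ⟨T, c, h5, h6, h7⟩
    swap
    · have := h7.card_pos
      rw [h5] at hM; simp at hM; subst hM; simp at this
    subst h6
    have haQ : a ∈ Q := by rw [e1, h5]; simp
    by_cases hay : Gᶜ.Adj y a
    · refine C.ns ⟨0, {q} + ({o} + ({y} + ({a} + ({p} + ({e} + {e'}))))), HC.zero, ?_, ?_⟩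
      · exact (HP.cons hoq (HP.cons (h.OO o ho y hy' hyo) (HP.cons hay (HP.cons e3
          (HP.cons (h.hX e he).2 (HP.cons (h.EE e he e' he'E hee) (HP.single e'))))))).close
          (h.hX e' he'E).1.symm
      · rw [← h.cf.hU, eE, eE', eO, eO', e1, h5]; simp only [add_zero, zero_add]; abel
    · have hay' := red (h.cf.ne (h.mO hy') haQ) hay
      refine C.ns ⟨{y} + {a}, {q} + ({o} + ({p} + ({e} + {e'}))), ?_, ?_, ?_⟩
      · exact (HP.cons hay' (HP.single a)).close hay'.symm
      · exact (HP.cons hoq (HP.cons hop.symm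
          (HP.cons (h.hX e he).2 (HP.cons (h.EE e he e' he'E hee) (HP.single e'))))).close
          (h.hX e' he'E).1.symm
      · rw [← h.cf.hU, eE, eE', eO, eO', e1, h5]; simp only [add_zero]; abel
  · obtain ⟨y', O3, eO2, hy2⟩ := getany (S := O2) (by omega)
    have hy2' : y' ∈ O' := by rw [eO']; exact Multiset.mem_add.2 (Or.inr hy2)
    have hy2O : y' ∈ O := by rw [eO]; exact Multiset.mem_add.2 (Or.inr hy2')
    have hyy : y ≠ y' := ndne (eO' ▸ ndO') hy2
    have hyo2 : o ≠ y' := ndne (eO ▸ ndO) hy2'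
    have rq := hq y hy' hyo.symm
    have rq' := hq y' hy2O hyo2.symm
    obtain ⟨T, q2, t1, t2, t3⟩ := h.cf.hQ.dec2 (by omega)
    have key : ∀ (e : V) (E' : Multiset V), E = {e} + E' →
        Cf G m ({q} + (O + E')) (T + {e}) q2 e := by
      intro e E' eE
      have he : e ∈ E := by rw [eE]; simp
      have hE' : ∀ x ∈ E', x ∈ E := fun x hx => by rw [eE]; exact Multiset.mem_add.2 (Or.inr hx)
      have cE : Multiset.card E = 1 + Multiset.card E' := by rw [eE]; simp [add_comm]
      refine ⟨?_, t3.snoc (h.hX e he).2, ?_, ?_⟩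
      · exact (HP.cons rq (bip2 (by omega) hy' hy2O hyy
          (fun x hx z hz => (h.EO z (hE' z hz) x hx).symm))).close rq'.symm
      · rw [← h.cf.hU, eE, t1]; abel
      · rw [← hcQ, t1]; simp [add_comm]
    obtain ⟨e, E', eE, he⟩ := getany (S := E) (by omega)
    have cE : Multiset.card E = 1 + Multiset.card E' := by rw [eE]; simp [add_comm]
    obtain ⟨e1, E2, eE', he1⟩ := getany (S := E') (by omega)
    have hE' : ∀ x ∈ E', x ∈ E := fun x hx => by rw [eE]; exact Multiset.mem_add.2 (Or.inr hx)
    have r1 : G.Adj q2 e1 := (key e1 ({e} + E2) (by rw [eE, eE']; abel)).qp C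
    have hcf := key e E' eE
    obtain ⟨O4, eO4⟩ := getm hy2O
    have hyO4 : y ∈ O4 := by
      have := hy'
      rw [eO4] at this
      rcases Multiset.mem_add.1 this with h9 | h9
      · exact (hyy (Multiset.mem_singleton.1 h9)).elim
      · exact h9
    have c4 : Multiset.card O = 1 + Multiset.card O4 := by rw [eO4]; simp [add_comm]
    have hb := bip (B := G) (Multiset.card O4) E' O4 e1 y (by omega) rfl he1 hyO4
      (fun x hx z hz => h.EO x (hE' x hx) z (by rw [eO4]; exact Multiset.mem_add.2 (Or.inr hz)))
    have hp := ((hb.snoc rq.symm).snoc rq').eqv (T := {q} + (O + E')) (by rw [eO4]; abel)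
    rcases hcf.f2 C hp with hx | hx
    · exact notboth r1 hx.1
    · exact notboth (h.EO e he y' hy2O) hx.2

theorem Fn.d (C : Ctx G m) (h : Fn G m E O Q q p) {o o' : V} (ho : o ∈ O) (ho' : o' ∈ O)
    (hne : o ≠ o') (hoq : Gᶜ.Adj q o) (hop : Gᶜ.Adj p o') : False := by
  have hm := h.cf.m3 C
  have hcQ := h.cf.hc
  have hcE := h.hc
  have h2 := h.h2
  have ndE := h.ndE
  have ndO := h.ndO
  obtain ⟨Q', q2, t1, t2, t3⟩ := h.cf.hQ.dec2 (by omega)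
  have cQ' : Multiset.card Q = 1 + Multiset.card Q' := by rw [t1]; simp [add_comm]
  have q2Q : q2 ∈ Q := by rw [t1]; exact Multiset.mem_add.2 (Or.inr t3.left)
  have r1 : ∀ x ∈ O, x ≠ o → G.Adj q2 x := by
    intro x hx hxo
    by_contra hcon
    have hb := blue (h.cf.ne (h.mO hx) q2Q).symm hcon
    obtain ⟨e, E', eE, he⟩ := getany (S := E) (by omega)
    obtain ⟨e', he', hee⟩ := h.otherE he
    refine C.ns ⟨0, _, HC.zero, (((HP.cons hoq (cliqueHP ndO h.OO ho hx hxo.symm)).join hb.symm t3).join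
      (h.hX e he).2 (cliqueHP ndE h.EE he he' hee)).close (h.hX e' he').1.symm, ?_⟩
    rw [← h.cf.hU, t1, zero_add]; abel
  have r2 : ∀ e ∈ E, G.Adj q2 e := by
    intro e he
    by_contra hcon
    have hb := blue (h.cf.ne (h.mE he) q2Q).symm hcon
    obtain ⟨e', he', hee⟩ := h.otherE he
    refine C.ns ⟨0, _, HC.zero, (((HP.cons hoq (cliqueHP ndO h.OO ho ho' hne)).join hop.symm t3.rev).join
      hb (cliqueHP ndE h.EE he he' hee)).close (h.hX e' he').1.symm, ?_⟩
    rw [← h.cf.hU, t1, zero_add]; abel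
  obtain ⟨Q3, q3, s1, s2, s3⟩ := t3.dec2 (by omega)
  have cQ3 : Multiset.card Q' = 1 + Multiset.card Q3 := by rw [s1]; simp [add_comm]
  have q3Q : q3 ∈ Q := by
    rw [t1, s1]; exact Multiset.mem_add.2 (Or.inr (Multiset.mem_add.2 (Or.inr s3.left)))
  obtain ⟨e, E', eE, he⟩ := getany (S := E) (by omega)
  have hE' : ∀ x ∈ E', x ∈ E := fun x hx => by rw [eE]; exact Multiset.mem_add.2 (Or.inr hx)
  have cE : Multiset.card E = 1 + Multiset.card E' := by rw [eE]; simp [add_comm]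
  obtain ⟨O1, eO⟩ := getm ho
  have ho1 : o' ∈ O1 := by
    rw [eO] at ho'
    rcases Multiset.mem_add.1 ho' with h9 | h9
    · exact (hne (Multiset.mem_singleton.1 h9).symm).elim
    · exact h9
  obtain ⟨O2, eO1⟩ := getm ho1
  have cO : Multiset.card O = 1 + Multiset.card O1 := by rw [eO]; simp [add_comm]
  have cO1 : Multiset.card O1 = 1 + Multiset.card O2 := by rw [eO1]; simp [add_comm]
  have hO1 : ∀ x ∈ O1, x ∈ O := fun x hx => by rw [eO]; exact Multiset.mem_add.2 (Or.inr hx)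
  have hO2 : ∀ x ∈ O2, x ∈ O := fun x hx => hO1 x (by rw [eO1]; exact Multiset.mem_add.2 (Or.inr hx))
  obtain ⟨e1, es, he1, hes, P⟩ := bip1 (B := G) (S := E') (T := O2) (by omega)
    (fun x hx y hy => h.EO x (hE' x hx) y (hO2 y hy))
  have hblue : HP Gᶜ ({o} + ({q} + ({e} + Q3))) o q3 :=
    HP.cons hoq.symm (HP.cons (h.hX e he).1 (HP.cons (h.hX e he).2.symm s3.rev))
  by_cases b1 : Gᶜ.Adj q3 o
  · have hb := bip (B := G) (Multiset.card O1) E' O1 e1 o' (by omega) rfl he1 ho1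
      (fun x hx y hy => h.EO x (hE' x hx) y (hO1 y hy))
    refine C.ns ⟨_, _, (hb.snoc (r1 o' ho' hne.symm).symm).close (r2 e1 (hE' e1 he1)),
      hblue.close b1, ?_⟩
    rw [← h.cf.hU, t1, s1, eE, eO]; abel
  have b1' := red (h.cf.ne (h.mO ho) q3Q).symm b1
  by_cases b2 : Gᶜ.Adj q3 o'
  · refine C.ns ⟨_, _, (P.snoc (r2 es (hE' es hes)).symm).close (r2 e1 (hE' e1 he1)),
      (hblue.snoc b2).close (h.OO o ho o' ho' hne).symm, ?_⟩
    rw [← h.cf.hU, t1, s1, eE, eO, eO1]; abel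
  have b2' := red (h.cf.ne (h.mO ho') q3Q).symm b2
  rcases s3.dec with ⟨h5, h6⟩ | ⟨Q4, q4, u1, u2, u3⟩
  · subst h6; exact notboth b2' hop
  have cQ4 : Multiset.card Q3 = 1 + Multiset.card Q4 := by rw [u1]; simp [add_comm]
  have := C.mn _ _ _ _ (((((P.snoc (r2 es (hE' es hes)).symm).snoc (r1 o' ho' hne.symm)).snoc b2'.symm).snoc
    b1').close (h.EO e1 (hE' e1 he1) o ho).symm)
    (HP.cons (h.hX e he).1 (HP.cons (h.hX e he).2.symm u3.rev)) (by
      rw [← h.cf.hU, t1, s1, u1, eE, eO, eO1]; abel)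
  simp at this
  omega

theorem Ce.false (C : Ctx G m) (h : Ce G m k f Q q p) : False := by
  have hk := h.k2
  have hcy := h.cp.cy
  have mE : ∀ e, e ∈ sg f 2 0 k → ∃ i, e = f (2 * i) := by
    intro e he
    rw [mem_sg] at he
    obtain ⟨j, -, rfl⟩ := he
    exact ⟨j, by rw [zero_add]⟩
  have mO : ∀ e, e ∈ sg f 2 1 k → ∃ i, e = f (2 * i + 1) := by
    intro e he
    rw [mem_sg] at he
    obtain ⟨j, -, rfl⟩ := he
    exact ⟨j, by rw [add_comm]⟩
  have mE' : ∀ i, f (2 * i) ∈ sg f 2 0 k := by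
    intro i
    rw [← h.Eeq i, mem_sg]
    exact ⟨0, by omega, by simp⟩
  have mO' : ∀ i, f (2 * i + 1) ∈ sg f 2 1 k := by
    intro i
    rw [← h.Oeq i, mem_sg]
    exact ⟨0, by omega, by simp⟩
  have hEO : ∀ e ∈ sg f 2 0 k, ∀ o ∈ sg f 2 1 k, G.Adj e o := by
    intro e he o ho
    obtain ⟨i, rfl⟩ := mE e he
    obtain ⟨j, rfl⟩ := mO o ho
    exact h.H C i j
  have hcf : Cf G m (sg f 2 0 k + sg f 2 1 k) Q q p := h.Req ▸ h.cp.cf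
  have gen : ∀ (S T : Multiset V), S + T = sg f 2 0 k + sg f 2 1 k → Multiset.card S = k →
      Multiset.card T = k → (∀ x ∈ S, ∀ y ∈ T, G.Adj x y) → (∃ x ∈ S, X G q p x) →
      ∀ a ∈ T, ∀ b ∈ T, a ≠ b → Gᶜ.Adj a b := by
    rintro S T e cS cT hST ⟨x, hx, hX⟩ a ha b hb hab
    obtain ⟨S', eS⟩ := getm hx
    have : Multiset.card S = 1 + Multiset.card S' := by rw [eS]; simp [add_comm]
    exact hcf.f3 C hX (R' := T + S') (by rw [← e, eS]; abel) (bip2 (by omega) ha hb hab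
      (fun u hu w hw => (hST w (by rw [eS]; exact Multiset.mem_add.2 (Or.inr hw)) u hu).symm))
  have hOO := gen _ _ rfl (card_sg _ _ _ _) (card_sg _ _ _ _) hEO ⟨f (2 * 0), mE' 0, h.hE 0⟩
  have hEE : ∀ e ∈ sg f 2 0 k, ∀ e' ∈ sg f 2 0 k, e ≠ e' → Gᶜ.Adj e e' := by
    by_cases hz : ∃ x ∈ sg f 2 1 k, X G q p x
    · exact gen _ _ (add_comm _ _) (card_sg _ _ _ _) (card_sg _ _ _ _)
        (fun x hx y hy => (hEO y hy x hx).symm) hz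
    · push Not at hz
      intro e he e' he' hne
      obtain ⟨i, rfl⟩ := mE e he
      obtain ⟨j, rfl⟩ := mE e' he'
      refine h.cp.hS C _ _ ⟨2 * (i - 1) + 1, by congr 1; ring, hz _ (mO' _)⟩
        ⟨2 * (j - 1) + 1, by congr 1; ring, hz _ (mO' _)⟩ hne
  have hF : Fn G m (sg f 2 0 k) (sg f 2 1 k) Q q p := ⟨hcf, fun e he => h.XE he, hEO, hEE, hOO,
    by rw [card_sg, card_sg], by rw [card_sg]; exact hk⟩
  have nall : ∀ {q p : V}, Ce G m k f Q q p → ∃ o ∈ sg f 2 1 k, Gᶜ.Adj q o := by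
    intro q p h
    by_contra hcon
    push Not at hcon
    have hr : ∀ i, G.Adj q (f (2 * i + 1)) := fun i =>
      red (h.cp.cf.ne (h.cp.mem _) h.cp.cf.hQ.left).symm (hcon _ (mO' i))
    refine h.cc1 C 0 1 ?_ (hr _) ?_ (hr _) ?_
    · have := hr (-1); norm_num at this ⊢; exact this
    · have := hr 0; norm_num at this ⊢; exact this
    · exact hcy.inj _ _ (by omega) (by push_cast; omega)
  obtain ⟨o, ho, hoq⟩ := nall h
  obtain ⟨o', ho', hop⟩ := nall h.symm
  by_cases hne : o = o'
  · subst hne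
    by_cases hy : ∃ y ∈ sg f 2 1 k, y ≠ o ∧ Gᶜ.Adj q y
    · obtain ⟨y, hy, hyo, hyq⟩ := hy
      exact hF.d C hy ho hyo hyq hop
    · push Not at hy
      exact hF.c C ho hoq hop (fun y hyO hyo => red (hcf.ne (hF.mO hyO) hcf.hQ.left).symm (hy y hyO hyo))
  · exact hF.d C ho ho' hne hoq hop

theorem Cp.false {r : ℕ} (C : Ctx G m) (h : Cp G m r f Q q p) : False := by
  obtain ⟨k, rfl⟩ := h.even_r C
  by_cases hE : ∀ i, X G q p (f (2 * i))
  · exact Ce.false C ⟨h, hE⟩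
  · push Not at hE
    obtain ⟨i, hi⟩ := hE
    refine Ce.false C ⟨h.shift 1, fun j => ?_⟩
    have := h.par C (j - i) hi
    rwa [show 2 * i + 2 * (j - i) + 1 = 2 * j + 1 by ring] at this
end

theorem HP.fn {G : SimpleGraph V} {S : Multiset V} {a b : V} (h : HP G S a b) :
    ∃ g : ℕ → V, g 0 = a ∧ g (Multiset.card S - 1) = b ∧
      (∀ i, i + 1 < Multiset.card S → G.Adj (g i) (g (i + 1))) ∧
      S = (Multiset.range (Multiset.card S)).map g := by
  induction h with
  | single a => exact ⟨fun _ => a, rfl, rfl, by simp, by simp⟩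
  | @cons a b c S h1 h2 ih =>
    obtain ⟨g, g0, g1, g2, g3⟩ := ih
    have hp := h2.card_pos
    refine ⟨fun n => Nat.casesOn n a g, rfl, ?_, ?_, ?_⟩
    · obtain ⟨n, hn⟩ : ∃ n, Multiset.card S = n + 1 := ⟨Multiset.card S - 1, by omega⟩
      simp only [Multiset.card_add, Multiset.card_singleton, hn]
      rw [hn] at g1
      have e : 1 + (n + 1) - 1 = n + 1 := by omega
      rw [e]; exact g1
    · intro i hi
      simp only [Multiset.card_add, Multiset.card_singleton] at hi
      cases i with
      | zero => simp only [g0]; exact h1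
      | succ i => exact g2 i (by omega)
    · have e : Multiset.card ({a} + S) = Multiset.card S + 1 := by simp [add_comm]
      rw [e]
      conv_lhs => rw [g3]
      have : Multiset.range (Multiset.card S + 1) = {0} + (Multiset.range (Multiset.card S)).map Nat.succ := by
        have := List.range_succ_eq_map (n := Multiset.card S)
        simp only [Multiset.range, this]
        rfl
      rw [this, Multiset.map_add, Multiset.map_map]
      rfl

theorem toCyc {G : SimpleGraph V} {S : Multiset V} {a b : V} (h : HP G S a b) (hba : G.Adj b a)
    (hn : S.Nodup) (h4 : 4 ≤ Multiset.card S) :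
    ∃ f : ℤ → V, Cyc G (Multiset.card S) f ∧ sg f 1 0 (Multiset.card S) = S := by
  obtain ⟨g, g0, g1, g2, g3⟩ := h.fn
  set r := Multiset.card S with hr
  have hr0 : (0 : ℤ) < r := by omega
  have ginj : ∀ i < r, ∀ j < r, g i = g j → i = j := by
    intro i hi j hj e
    rw [g3] at hn
    exact Multiset.inj_on_of_nodup_map hn i (Multiset.mem_range.2 hi) j (Multiset.mem_range.2 hj) e
  refine ⟨fun i => g (i % r).toNat, ⟨h4, ?_, ?_, ?_⟩, ?_⟩
  · intro i; simp
  · intro i j hij hj e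
    have a1 := Int.emod_nonneg i hr0.ne'
    have a2 := Int.emod_lt_of_pos i hr0
    have b1 := Int.emod_nonneg j hr0.ne'
    have b2 := Int.emod_lt_of_pos j hr0
    have := ginj _ (by omega) _ (by omega) e
    have e2 : j % r = i % r := by omega
    have hd := Int.ModEq.dvd (n := (r : ℤ)) e2.symm
    have := Int.le_of_dvd (by omega) hd
    omega
  · intro i
    have a1 := Int.emod_nonneg i hr0.ne'
    have a2 := Int.emod_lt_of_pos i hr0
    have e : (i + 1) % r = (i % r + 1) % r := by simp
    by_cases hl : i % r + 1 = r
    · have e1 : (i + 1) % r = 0 := by rw [e, hl, Int.emod_self]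
      simp only [e1]
      rw [show (i % (r : ℤ)).toNat = r - 1 by omega, g1]
      simpa [g0] using hba
    · have e1 : (i + 1) % r = i % r + 1 := by
        rw [e]; exact Int.emod_eq_of_lt (by omega) (by omega)
      simp only [e1]
      rw [show (i % (r : ℤ) + 1).toNat = (i % (r : ℤ)).toNat + 1 by omega]
      exact g2 _ (by omega)
  · have : ∀ n : ℕ, n ≤ r → sg (fun i : ℤ => g (i % r).toNat) 1 0 n = (Multiset.range n).map g := by
      intro n
      induction n with
      | zero => intro _; rfl
      | succ n ih =>
        intro hn
        rw [sg_last, ih (by omega), Multiset.range_succ, Multiset.map_cons, ← Multiset.singleton_add,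
          add_comm]
        congr 3
        have : (0 + 1 * (n : ℤ)) % r = n := by
          rw [zero_add, one_mul]; exact Int.emod_eq_of_lt (by omega) (by omega)
        rw [this]; simp
    rw [this r le_rfl, ← g3]

theorem eq0 {a : V} {B : Multiset V} (h : {a} + B = {a}) : B = 0 := by
  apply add_left_cancel (a := {a}); rw [h, add_zero]

theorem gyarfas [Fintype V] (G : SimpleGraph V) (S : Multiset V) (hn : S.Nodup) : S = 0 ∨ ∃ A B a x y,
    HP G ({a} + A) a x ∧ HP Gᶜ ({a} + B) a y ∧ S = {a} + A + B := by
  induction S using Multiset.induction_on with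
  | empty => left; rfl
  | cons v S ih =>
    right
    rw [Multiset.nodup_cons] at hn
    rw [← Multiset.singleton_add]
    rcases ih hn.2 with rfl | ⟨A, B, a, x, y, hA, hB, e⟩
    · exact ⟨0, 0, v, v, v, by simpa using HP.single v, by simpa using HP.single v, by simp⟩
    have hvx : v ≠ x := by
      rintro rfl
      apply hn.1; rw [e]; exact Multiset.mem_add.2 (Or.inl hA.right)
    have hvy : v ≠ y := by
      rintro rfl
      apply hn.1; rw [e]
      have := hB.right
      simp only [Multiset.mem_add] at this ⊢
      tauto
    by_cases h1 : G.Adj x v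
    · exact ⟨A + {v}, B, a, v, y, (hA.snoc h1).eqv (by abel), hB, by rw [e]; abel⟩
    by_cases h2 : Gᶜ.Adj y v
    · exact ⟨A, B + {v}, a, x, v, hA, (hB.snoc h2).eqv (by abel), by rw [e]; abel⟩
    have h1' := blue hvx.symm h1
    have h2' := red hvy.symm h2
    have hxy : x ≠ y := by rintro rfl; exact h1 h2'
    by_cases h3 : G.Adj x y
    · rcases hB.rev.dec with ⟨e1, e2⟩ | ⟨T, c, e1, e2, e3⟩
      · subst e2
        have : B = 0 := by exact eq0 e1
        subst this
        exact ⟨{y} + A, 0, v, x, v, HP.cons h2'.symm hA, by simpa using HP.single v, by rw [e]; abel⟩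
      · obtain ⟨B1, rfl⟩ := getm e3.right
        have : B = {y} + B1 := by
          apply add_left_cancel (a := {a}); rw [e1]; abel
        exact ⟨A + {y} + {v}, B1, a, v, c, ((hA.snoc h3).snoc h2').eqv (by abel), e3.rev,
          by rw [e, this]; abel⟩
    · have h3' := blue hxy h3
      rcases hA.rev.dec with ⟨e1, e2⟩ | ⟨T, c, e1, e2, e3⟩
      · subst e2
        have : A = 0 := by exact eq0 e1
        subst this
        exact ⟨0, {x} + B, v, v, y, by simpa using HP.single v, HP.cons h1'.symm hB, by rw [e]; abel⟩
      · obtain ⟨A1, rfl⟩ := getm e3.right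
        have : A = {x} + A1 := by
          apply add_left_cancel (a := {a}); rw [e1]; abel
        exact ⟨A1, B + {x} + {v}, a, c, v, e3.rev, ((hB.snoc h3'.symm).snoc h1').eqv (by abel),
          by rw [e, this]; abel⟩

section
variable [Fintype V]

theorem Cf.false {G : SimpleGraph V} {m : ℕ} {R Q : Multiset V} {q p : V} (C : Ctx G m)
    (h : Cf G m R Q q p) : False := by
  obtain ⟨a, b, h1, h2, h3⟩ := h.r4 C
  obtain ⟨f, hf, e⟩ := toCyc h1 h2 h.ndR h3
  exact Cp.false (f := f) (r := Multiset.card R) C ⟨by rw [e]; exact h, hf⟩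

def Conf1 (G : SimpleGraph V) (n : ℕ) : Prop := ∃ R Q a b, HC G R ∧ HP Gᶜ Q a b ∧
  R + Q = (Finset.univ : Finset V).val ∧ Multiset.card Q = n

theorem confR {G : SimpleGraph V} {A B : Multiset V} {a x y : V} (hA : HP G ({a} + A) a x)
    (hB : HP Gᶜ ({a} + B) a y) (e : (Finset.univ : Finset V).val = {a} + A + B) (hxy : G.Adj x y) :
    Sol G ∨ (∃ n, Conf1 G n) ∨ ∃ n, Conf1 Gᶜ n := by
  rcases hB.rev.dec with ⟨e1, e2⟩ | ⟨T, c, e1, e2, e3⟩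
  · have : B = 0 := by subst e2; exact eq0 e1
    subst this
    right; right
    refine ⟨_, 0, {a} + A, a, x, HC.zero, ?_, ?_, rfl⟩
    · rwa [compl_compl]
    · rw [e]; abel
  · obtain ⟨B1, rfl⟩ := getm e3.right
    have hB1 : B = {y} + B1 := by
      apply add_left_cancel (a := {a}); rw [e1]; abel
    have hne : a ≠ y := by
      have hn : (Finset.univ : Finset V).val.Nodup := Finset.univ.nodup
      rw [e, hB1, show {a} + A + ({y} + B1) = {a} + (A + ({y} + B1)) by abel] at hn
      exact ndne hn (by simp)
    by_cases hay : G.Adj y a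
    · have hc : HC G ({a} + A + {y}) := (hA.snoc hxy).close hay
      rcases e3.rev.dec with ⟨f1, f2⟩ | ⟨T, d, f1, f2, f3⟩
      · have : B1 = 0 := by exact eq0 f1
        subst this
        left
        exact ⟨_, 0, hc, HC.zero, by rw [e, hB1]; abel⟩
      · right; left
        have : B1 = T := add_left_cancel f1
        subst this
        exact ⟨_, _, _, d, c, hc, f3, by rw [e, hB1]; abel, rfl⟩
    · have hc := hB.close (blue hne.symm hay)
      rcases hA.dec with ⟨f1, f2⟩ | ⟨T, d, f1, f2, f3⟩
      · have : A = 0 := by exact eq0 f1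
        subst this
        left
        exact ⟨0, _, HC.zero, hc, by rw [e]; abel⟩
      · right; right
        have : A = T := add_left_cancel f1
        subst this
        exact ⟨_, _, _, d, x, hc, by rwa [compl_compl], by rw [e]; abel, rfl⟩

theorem confE (G : SimpleGraph V) : Sol G ∨ (∃ n, Conf1 G n) ∨ ∃ n, Conf1 Gᶜ n := by
  rcases gyarfas G (Finset.univ : Finset V).val Finset.univ.nodup with h0 | ⟨A, B, a, x, y, hA, hB, e⟩
  · left; exact ⟨0, 0, HC.zero, HC.zero, by rw [h0]; rfl⟩
  by_cases hxy : x = y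
  · subst hxy
    rcases hA.dec with ⟨f1, f2⟩ | ⟨T, d, f1, f2, f3⟩
    · have : A = 0 := by exact eq0 f1
      subst this
      right; left
      exact ⟨_, 0, _, a, x, HC.zero, hB, by rw [e]; abel, rfl⟩
    rcases hB.dec with ⟨g1, g2⟩ | ⟨T', d', g1, g2, g3⟩
    · have : B = 0 := by exact eq0 g1
      subst this
      right; right
      exact ⟨_, 0, {a} + A, a, x, HC.zero, by rwa [compl_compl], by rw [e]; abel, rfl⟩
    exfalso
    have e1 : A = T := add_left_cancel f1
    have e2 : B = T' := add_left_cancel g1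
    have hn : (Finset.univ : Finset V).val.Nodup := Finset.univ.nodup
    rw [e, Multiset.nodup_add] at hn
    exact Multiset.disjoint_left.1 hn.2.2 (Multiset.mem_add.2 (Or.inr (e1 ▸ f3.right))) (e2 ▸ g3.right)
  by_cases h : G.Adj x y
  · exact confR hA hB e h
  · have := confR (G := Gᶜ) hB (by rwa [compl_compl]) (by rw [e]; abel) (blue hxy h).symm
    rw [compl_compl] at this
    rcases this with h1 | h1 | h1
    · exact Or.inl h1.compl
    · exact Or.inr (Or.inr h1)
    · exact Or.inr (Or.inl h1)

theorem lehel_aux (G : SimpleGraph V) (ns : ¬ Sol G) (m : ℕ) (h : Conf1 G m)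
    (h1 : ∀ n, Conf1 G n → m ≤ n) (h2 : ∀ n, Conf1 Gᶜ n → m ≤ n) : False := by
  obtain ⟨R, Q, a, b, hR, hQ, hU, hc⟩ := h
  refine Cf.false (G := G) (m := m) ⟨ns, ?_, ?_⟩ ⟨hR, hQ, hU, hc⟩
  · intro R Q a b u1 u2 u3
    exact h1 _ ⟨R, Q, a, b, u1, u2, u3, rfl⟩
  · intro R Q a b u1 u2 u3
    exact h2 _ ⟨R, Q, a, b, u1, by rwa [compl_compl], u3, rfl⟩

theorem lehel (G : SimpleGraph V) : Sol G := by
  classical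
  by_contra ns
  have hex : ∃ n, Conf1 G n ∨ Conf1 Gᶜ n := by
    rcases confE G with h | ⟨n, h⟩ | ⟨n, h⟩
    · exact (ns h).elim
    · exact ⟨n, Or.inl h⟩
    · exact ⟨n, Or.inr h⟩
  have hm : ∀ n, Conf1 G n ∨ Conf1 Gᶜ n → Nat.find hex ≤ n := fun n hn => Nat.find_min' hex hn
  rcases Nat.find_spec hex with h | h
  · exact lehel_aux G ns _ h (fun n hn => hm n (Or.inl hn)) (fun n hn => hm n (Or.inr hn))
  · exact lehel_aux Gᶜ (fun hs => ns hs.compl) _ h (fun n hn => hm n (Or.inr hn))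
      (fun n hn => hm n (Or.inl (by rwa [compl_compl] at hn)))
end

theorem HP.split {G : SimpleGraph V} {S : Multiset V} {a b : V} (h : HP G S a b) {v : V}
    (hv : v ∈ S) : ∃ S1 S2, S = S1 + {v} + S2 ∧ (S1 = 0 ∨ ∃ c, HP G S1 a c) ∧
      (S2 = 0 ∨ ∃ d, HP G S2 d b) := by
  induction h with
  | single a =>
    rw [Multiset.mem_singleton] at hv
    subst hv
    exact ⟨0, 0, by simp, Or.inl rfl, Or.inl rfl⟩
  | @cons a b c S h1 h2 ih =>
    rcases Multiset.mem_add.1 hv with h3 | h3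
    · rw [Multiset.mem_singleton] at h3
      subst h3
      exact ⟨0, S, by simp, Or.inl rfl, Or.inr ⟨b, h2⟩⟩
    · obtain ⟨S1, S2, e, h4, h5⟩ := ih h3
      refine ⟨{a} + S1, S2, by rw [e]; abel, Or.inr ?_, h5⟩
      rcases h4 with rfl | ⟨d, h4⟩
      · exact ⟨a, (HP.single a).eqv (by simp)⟩
      · exact ⟨d, HP.cons h1 h4⟩

theorem HC.remove {G : SimpleGraph V} {S : Multiset V} (h : HC G S) (hn : S.Nodup) {v : V}
    (hv : v ∈ S) : ∃ T, S = {v} + T ∧ (T = 0 ∨ ∃ c d, HP G T c d) := by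
  rcases h with rfl | ⟨a, b, h, hab⟩
  · simp at hv
  obtain ⟨S1, S2, e, h1, h2⟩ := h.split hv
  refine ⟨S2 + S1, by rw [e]; abel, ?_⟩
  rcases h1 with rfl | ⟨c, h1⟩ <;> rcases h2 with rfl | ⟨d, h2⟩
  · left; rfl
  · right; exact ⟨d, b, h2.eqv (by simp)⟩
  · right; exact ⟨a, c, h1.eqv (by simp)⟩
  · right
    rcases hab with rfl | hab
    · exfalso
      rw [e, add_assoc, Multiset.nodup_add] at hn
      exact Multiset.disjoint_left.1 hn.2.2 h1.left (Multiset.mem_add.2 (Or.inr h2.right))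
    · exact ⟨d, c, h2.join hab h1⟩

theorem HP.walk {G : SimpleGraph V} {S : Multiset V} {a b : V} (h : HP G S a b) (hn : S.Nodup) :
    ∃ w : G.Walk a b, w.IsPath ∧ (w.support : Multiset V) = S := by
  induction h with
  | single a => exact ⟨SimpleGraph.Walk.nil, by simp, by simp⟩
  | @cons a b c S h1 h2 ih =>
    obtain ⟨w, hw, e⟩ := ih (Multiset.nodup_add.1 hn).2.1
    refine ⟨SimpleGraph.Walk.cons h1 w, ?_, ?_⟩
    · rw [SimpleGraph.Walk.cons_isPath_iff]
      refine ⟨hw, fun ha => ?_⟩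
      exact ndne hn (b := a) (by rw [← e]; exact ha) rfl
    · rw [SimpleGraph.Walk.support_cons, ← Multiset.cons_coe, e, Multiset.singleton_add]

theorem HP.cycle {G : SimpleGraph V} {S : Multiset V} {a b : V} (h : HP G S a b) (hn : S.Nodup)
    (hba : G.Adj b a) (h3 : 3 ≤ Multiset.card S) :
    ∃ w : G.Walk b b, w.IsCycle ∧ ∀ x, x ∈ w.support ↔ x ∈ S := by
  obtain ⟨T, c, e, hac, hT⟩ := h.dec2 (by omega)
  have hTn : T.Nodup := by rw [e] at hn; exact (Multiset.nodup_add.1 hn).2.1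
  obtain ⟨w, hw, ew⟩ := hT.walk hTn
  have haw : a ∉ w.support := by
    intro ha
    have : a ∈ T := by rw [← ew]; exact ha
    rw [e] at hn
    exact ndne hn this rfl
  refine ⟨SimpleGraph.Walk.cons hba (SimpleGraph.Walk.cons hac w), ?_, ?_⟩
  · rw [SimpleGraph.Walk.cons_isCycle_iff, SimpleGraph.Walk.cons_isPath_iff]
    refine ⟨⟨hw, haw⟩, ?_⟩
    rw [SimpleGraph.Walk.edges_cons, List.mem_cons]
    rintro (h1 | h1)
    · have hbc : b = c := by
        rw [Sym2.eq_iff] at h1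
        rcases h1 with ⟨h1, h2⟩ | ⟨h1, h2⟩
        · exact (hba.ne h1).elim
        · exact h1
      subst hbc
      have hc : Multiset.card S = 1 + Multiset.card T := by rw [e]; simp [add_comm]
      obtain ⟨T', c', e', h4, h5⟩ := hT.dec2 (by omega)
      rw [e'] at hTn
      exact ndne hTn h5.right rfl
    · exact haw (SimpleGraph.Walk.snd_mem_support_of_mem_edges _ h1)
  · intro x
    have hb : b ∈ T := hT.right
    have : x ∈ w.support ↔ x ∈ T := by rw [← ew]; rfl
    simp only [SimpleGraph.Walk.support_cons, List.mem_cons, this, e, Multiset.mem_add,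
      Multiset.mem_singleton]
    constructor
    · rintro (rfl | h | h)
      · exact Or.inr hb
      · exact Or.inl h
      · exact Or.inr h
    · tauto

theorem toMono {n : ℕ} (χ : Fin n → Fin n → ℕ) (col : ℕ) {K : SimpleGraph (Fin n)}
    {S : Multiset (Fin n)} (h : HC K S) (hn : S.Nodup)
    (hK : ∀ x ∈ S, ∀ y ∈ S, K.Adj x y → χ x y = col) : IsMonoCycle χ col S.toFinset := by
  rcases h with rfl | ⟨a, b, h, hab⟩
  · left; rfl
  right
  rcases h.dec with ⟨e1, e2⟩ | ⟨T, c, e1, e2, e3⟩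
  · left; exact ⟨a, by rw [e1]; simp⟩
  right
  have hab' : K.Adj b a := by
    rcases hab with rfl | hab
    · rw [e1] at hn
      exact (ndne hn e3.right rfl).elim
    · exact hab
  by_cases h3 : 3 ≤ Multiset.card S
  · right
    obtain ⟨w, hw, hs⟩ := h.cycle hn hab' h3
    refine ⟨b, w.mapLe le_top, hw.mapLe le_top, ?_, ?_⟩
    · ext x
      simp [hs]
    · intro x y hxy
      have hxy' : s(x, y) ∈ w.edges := by simpa using hxy
      exact hK x ((hs x).1 (SimpleGraph.Walk.fst_mem_support_of_mem_edges _ hxy')) y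
        ((hs y).1 (SimpleGraph.Walk.snd_mem_support_of_mem_edges _ hxy'))
        (SimpleGraph.Walk.adj_of_mem_edges _ hxy')
  · left
    rcases e3.dec with ⟨f1, f2⟩ | ⟨T', c', f1, f2, f3⟩
    · subst f2
      refine ⟨a, c, e2.ne, ?_, hK a h.left c h.right e2⟩
      rw [e1, f1]
      ext x
      simp
    · exfalso
      have := f3.card_pos
      apply h3
      rw [e1, f1]
      simp only [Multiset.card_add, Multiset.card_singleton]
      omega

theorem colP {K : SimpleGraph V} (χ : V → V → ℕ) (hsymm : ∀ u v, χ u v = χ v u) (v : V)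
    (hl : ∀ u, u ≠ v → ∀ x y, K.Adj u x → K.Adj u y → χ u x = χ u y) (β : ℕ)
    {S : Multiset V} {a b : V} (h : HP K S a b) (hv : v ∉ S) (ha : ∀ x, K.Adj a x → χ a x = β) :
    ∀ s ∈ S, ∀ x, K.Adj s x → χ s x = β := by
  induction h with
  | single a =>
    intro s hs
    rw [Multiset.mem_singleton] at hs
    subst hs; exact ha
  | @cons a b c S h1 h2 ih =>
    have hv' : v ∉ S := fun h => hv (Multiset.mem_add.2 (Or.inr h))
    have hb : b ≠ v := by rintro rfl; exact hv' h2.left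
    have := ih hv' (fun x hx => by
      rw [hl b hb x a hx h1.symm, hsymm, ha b h1])
    intro s hs
    rcases Multiset.mem_add.1 hs with h3 | h3
    · rw [Multiset.mem_singleton] at h3
      subst h3; exact ha
    · exact this s h3

theorem colC {K : SimpleGraph V} (χ : V → V → ℕ) (hsymm : ∀ u v, χ u v = χ v u) (v : V) (α : ℕ)
    (hα : ∀ x y, K.Adj x y → χ x y ≠ α)
    (hl : ∀ u, u ≠ v → ∀ x y, K.Adj u x → K.Adj u y → χ u x = χ u y)
    {S : Multiset V} (h : HC K S) (hn : S.Nodup) :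
    ∃ β, β ≠ α ∧ ∀ x ∈ S, ∀ y ∈ S, K.Adj x y → χ x y = β := by
  have hcol : ∀ u, u ≠ v → ∃ β, β ≠ α ∧ ∀ x, K.Adj u x → χ u x = β := by
    intro u hu
    by_cases hx : ∃ x, K.Adj u x
    · obtain ⟨x, hx⟩ := hx
      exact ⟨χ u x, hα _ _ hx, fun y hy => hl u hu y x hy hx⟩
    · push Not at hx
      exact ⟨α + 1, by omega, fun y hy => (hx y hy).elim⟩
  by_cases hv : v ∈ S
  · obtain ⟨T, e, hT⟩ := h.remove hn hv
    rcases hT with rfl | ⟨c, d, hT⟩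
    · refine ⟨α + 1, by omega, fun x hx y hy hxy => ?_⟩
      rw [e] at hx hy
      simp at hx hy
      subst hx; subst hy
      exact (hxy.ne rfl).elim
    · have hvT : v ∉ T := fun hh => ndne (e ▸ hn) hh rfl
      obtain ⟨β, hβ, hc⟩ := hcol c (by rintro rfl; exact hvT hT.left)
      have := colP χ hsymm v hl β hT hvT hc
      refine ⟨β, hβ, fun x hx y hy hxy => ?_⟩
      rw [e] at hx hy
      rcases Multiset.mem_add.1 hx with h1 | h1
      · rcases Multiset.mem_add.1 hy with h2 | h2
        · rw [Multiset.mem_singleton] at h1 h2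
          subst h1; subst h2
          exact (hxy.ne rfl).elim
        · rw [hsymm]; exact this y h2 x hxy.symm
      · exact this x h1 y hxy
  · rcases h with rfl | ⟨a, b, h, -⟩
    · exact ⟨α + 1, by omega, by simp⟩
    · obtain ⟨β, hβ, hc⟩ := hcol a (by rintro rfl; exact hv h.left)
      exact ⟨β, hβ, fun x hx y _ hxy => colP χ hsymm v hl β h hv hc x hx y hxy⟩

end Lehel

/-- If the edges of `K_n` are coloured so that every vertex except possibly `v` sees at most
one colour other than `α`, then there are two disjoint monochromatic cycles of different
colours, one of them of colour `α`, covering all vertices. -/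
theorem one_exceptional_vertex (n : ℕ) (χ : Fin n → Fin n → ℕ)
    (hsymm : ∀ u v, χ u v = χ v u)
    (α : ℕ) (v : Fin n)
    (hloc : ∀ u : Fin n, u ≠ v →
      ((((Finset.univ.erase u).image (χ u)).erase α).card ≤ 1)) :
    ∃ (S₁ S₂ : Finset (Fin n)) (β : ℕ), β ≠ α ∧
      IsMonoCycle χ α S₁ ∧ IsMonoCycle χ β S₂ ∧
      Disjoint S₁ S₂ ∧ S₁ ∪ S₂ = Finset.univ := by
  classical
  let G : SimpleGraph (Fin n) :=
    { Adj := fun x y => x ≠ y ∧ χ x y = α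
      symm := ⟨fun x y h => ⟨h.1.symm, by rw [hsymm]; exact h.2⟩⟩
      loopless := ⟨fun x h => h.1 rfl⟩ }
  have hG : ∀ x y, G.Adj x y → χ x y = α := fun x y h => h.2
  have hGc : ∀ x y, Gᶜ.Adj x y → x ≠ y ∧ χ x y ≠ α := by
    intro x y h
    rw [SimpleGraph.compl_adj] at h
    exact ⟨h.1, fun e => h.2 ⟨h.1, e⟩⟩
  obtain ⟨S, T, hS, hT, hU⟩ := Lehel.lehel G
  have hn := Lehel.nodupU _ _ hU
  rw [Multiset.nodup_add] at hn
  obtain ⟨β, hβ, hc⟩ := Lehel.colC χ hsymm v α (fun x y h => (hGc x y h).2) (fun u hu x y hx hy => by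
    have hmem : ∀ x, Gᶜ.Adj u x → χ u x ∈ ((Finset.univ.erase u).image (χ u)).erase α := by
      intro x hx
      have := hGc u x hx
      rw [Finset.mem_erase, Finset.mem_image]
      exact ⟨this.2, x, by simp [this.1.symm], rfl⟩
    exact Finset.card_le_one.1 (hloc u hu) _ (hmem x hx) _ (hmem y hy)) hT hn.2.1
  refine ⟨S.toFinset, T.toFinset, β, hβ, Lehel.toMono χ α hS hn.1 (fun x _ y _ h => hG x y h),
    Lehel.toMono χ β hT hn.2.1 hc, ?_, ?_⟩
  · rw [Finset.disjoint_left]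
    intro x hx hy
    rw [Multiset.mem_toFinset] at hx hy
    exact Multiset.disjoint_left.1 hn.2.2 hx hy
  · ext x
    have : x ∈ S + T := by rw [hU]; exact Finset.mem_univ x
    simpa [Multiset.mem_add] using this
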